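/- Fix integers n and k with 3 ≤ k ≤ n. For every integer i ≥ 1 that is not of the form t(k−2) for some integer t ≥ 1, the singular homology group H_i(M_{n,k}; ℤ) is trivial. -/

import Mathlib

open CategoryTheory

/-- The singular chain complex of a topological space with `ℤ` coefficients. -/
noncomputable def singularChainComplex (X : TopCat) : ChainComplex (ModuleCat ℤ) ℕ :=
  (AlgebraicTopology.alternatingFaceMapComplex (ModuleCat ℤ)).obj
    (((SimplicialObject.whiskering _ _).obj (ModuleCat.free ℤ)).obj (TopCat.toSSet.obj X))

/-- The `i`-th singular homology of a topological space with `ℤ` coefficients. -/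
noncomputable def singularHomology (X : TopCat) (i : ℕ) : ModuleCat ℤ :=
  (singularChainComplex X).homology i

/-- The complement of the `k`-equal arrangement in `ℝ^{n+1}`. -/
def kEqualComplement (n k : ℕ) : Set (Fin (n + 1) → ℝ) :=
  {x | ∀ S : Finset (Fin (n + 1)), S.card = k → ¬ (∀ i ∈ S, ∀ j ∈ S, x i = x j)}


namespace KEq

/-- Concrete singular chains. -/
abbrev SC (n : ℕ) (X : Type) [TopologicalSpace X] : Type :=
  C(stdSimplex ℝ (Fin (n + 1)), X) →₀ ℤ

/-- The map of simplices induced by a map of vertices. -/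
noncomputable def smap {m n : ℕ} (f : Fin (m + 1) → Fin (n + 1)) :
    C(stdSimplex ℝ (Fin (m + 1)), stdSimplex ℝ (Fin (n + 1))) :=
  ⟨stdSimplex.map f, stdSimplex.continuous_map f⟩

/-- The boundary. -/
noncomputable def bd (n : ℕ) (X : Type) [TopologicalSpace X] : SC (n + 1) X →ₗ[ℤ] SC n X :=
  Finsupp.linearCombination ℤ (fun σ : C(stdSimplex ℝ (Fin (n + 2)), X) =>
    ∑ j : Fin (n + 2), ((-1 : ℤ) ^ (j : ℕ)) •
      Finsupp.single (σ.comp (smap j.succAbove)) (1 : ℤ))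

/-- Pushforward of chains. -/
noncomputable def pf (n : ℕ) {X Y : Type} [TopologicalSpace X] [TopologicalSpace Y]
    (f : C(X, Y)) : SC n X →ₗ[ℤ] SC n Y :=
  Finsupp.lmapDomain ℤ ℤ (fun σ => f.comp σ)

lemma bd_single (n : ℕ) (X : Type) [TopologicalSpace X] (σ : C(stdSimplex ℝ (Fin (n + 2)), X)) :
    bd n X (Finsupp.single σ 1) = ∑ j : Fin (n + 2), ((-1 : ℤ) ^ (j : ℕ)) •
      Finsupp.single (σ.comp (smap j.succAbove)) (1 : ℤ) := by
  simp [bd]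

@[simp] lemma pf_single (n : ℕ) {X Y : Type} [TopologicalSpace X] [TopologicalSpace Y]
    (f : C(X, Y)) (σ : C(stdSimplex ℝ (Fin (n + 1)), X)) (a : ℤ) :
    pf n f (Finsupp.single σ a) = Finsupp.single (f.comp σ) a := by
  simp [pf]

lemma bd_pf (n : ℕ) {X Y : Type} [TopologicalSpace X] [TopologicalSpace Y]
    (f : C(X, Y)) (c : SC (n + 1) X) : bd n Y (pf (n + 1) f c) = pf n f (bd n X c) := by
  have : (bd n Y) ∘ₗ (pf (n + 1) f) = (pf n f) ∘ₗ (bd n X) := by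
    ext1 σ
    ext1
    simp only [LinearMap.comp_apply, Finsupp.lsingle_apply, pf_single, bd_single, map_sum, map_smul,
      ContinuousMap.comp_assoc]
  exact LinearMap.congr_fun this c

lemma pf_comp (n : ℕ) {X Y Z : Type} [TopologicalSpace X] [TopologicalSpace Y] [TopologicalSpace Z]
    (f : C(X, Y)) (g : C(Y, Z)) (c : SC n X) : pf n (g.comp f) c = pf n g (pf n f c) := by
  have : pf n (g.comp f) = pf n g ∘ₗ pf n f := by
    ext1 σ
    ext1
    simp [ContinuousMap.comp_assoc]
  exact LinearMap.congr_fun this c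

lemma pf_id (n : ℕ) {X : Type} [TopologicalSpace X] (c : SC n X) :
    pf n (ContinuousMap.id X) c = c := by
  have : pf n (ContinuousMap.id X) = LinearMap.id := by
    ext1 σ
    ext1
    simp
  exact LinearMap.congr_fun this c

/-- Identification with the categorical chains. -/
noncomputable def toCat (n : ℕ) (X : Type) [TopologicalSpace X] :
    SC n X ≃ₗ[ℤ] (singularChainComplex (TopCat.of X)).X n :=
  Finsupp.domLCongr (TopCat.toSSetObjEquiv (TopCat.of X) (Opposite.op (SimplexCategory.mk n))).symm

lemma toCat_single (n : ℕ) (X : Type) [TopologicalSpace X] (σ) (a : ℤ) :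
    toCat n X (Finsupp.single σ a) = (Finsupp.single ((TopCat.toSSetObjEquiv (TopCat.of X) (Opposite.op (SimplexCategory.mk n))).symm σ) a : (_ →₀ ℤ)) := 
  Finsupp.domLCongr_single _ _ _

lemma altd_apply (M : SimplicialObject (ModuleCat ℤ)) (n : ℕ)
    (x : M.obj (Opposite.op (SimplexCategory.mk (n + 1)))) :
    (((AlgebraicTopology.alternatingFaceMapComplex (ModuleCat ℤ)).obj M).d (n + 1) n).hom x =
      ∑ j : Fin (n + 2), ((-1 : ℤ) ^ (j : ℕ)) • (M.δ j).hom x := by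
  rw [AlgebraicTopology.alternatingFaceMapComplex_obj_d]
  simp only [AlgebraicTopology.AlternatingFaceMapComplex.objD]
  rw [ModuleCat.hom_sum, LinearMap.sum_apply]
  rfl

lemma toCat_bd (n : ℕ) (X : Type) [TopologicalSpace X] (c : SC (n + 1) X) :
    toCat n X (bd n X c) = (singularChainComplex (TopCat.of X)).d (n + 1) n (toCat (n + 1) X c) := by
  have : (toCat n X).toLinearMap ∘ₗ (bd n X) =
    ((singularChainComplex (TopCat.of X)).d (n + 1) n).hom ∘ₗ (toCat (n + 1) X).toLinearMap := by
    ext1 σ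
    apply LinearMap.ext_ring
    simp only [LinearMap.comp_apply, Finsupp.lsingle_apply, bd_single, map_sum, map_zsmul, LinearEquiv.coe_coe]
    rw [toCat_single]
    refine Eq.trans ?_ (altd_apply (((SimplicialObject.whiskering _ _).obj
        (ModuleCat.free ℤ)).obj (TopCat.toSSet.obj (TopCat.of X))) n _).symm
    refine Finset.sum_congr rfl fun j _ => ?_
    congr 1
    rw [toCat_single]
    exact (ModuleCat.free_map_apply (R := ℤ) ((TopCat.toSSet.obj (TopCat.of X)).δ j) ((TopCat.toSSetObjEquiv (TopCat.of X) (Opposite.op (SimplexCategory.mk (n + 1)))).symm σ)).symm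
  exact LinearMap.congr_fun this c
/-- The categorical pushforward. -/
noncomputable def sccMap {X Y : Type} [TopologicalSpace X] [TopologicalSpace Y]
    (f : C(X, Y)) : singularChainComplex (TopCat.of X) ⟶ singularChainComplex (TopCat.of Y) :=
  (AlgebraicTopology.alternatingFaceMapComplex (ModuleCat ℤ)).map
    (((SimplicialObject.whiskering _ _).obj (ModuleCat.free ℤ)).map
      (TopCat.toSSet.map (TopCat.ofHom f)))

lemma toCat_pf (n : ℕ) {X Y : Type} [TopologicalSpace X] [TopologicalSpace Y]
    (f : C(X, Y)) (c : SC n X) :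
    toCat n Y (pf n f c) = (sccMap f).f n (toCat n X c) := by
  have : (toCat n Y).toLinearMap ∘ₗ (pf n f) =
    ((sccMap f).f n).hom ∘ₗ (toCat n X).toLinearMap := by
    ext1 σ
    apply LinearMap.ext_ring
    simp only [LinearMap.comp_apply, Finsupp.lsingle_apply, pf_single, LinearEquiv.coe_coe]
    rw [toCat_single, toCat_single]
    exact (ModuleCat.free_map_apply (R := ℤ)
      ((TopCat.toSSet.map (TopCat.ofHom f)).app (Opposite.op (SimplexCategory.mk n)))
      ((TopCat.toSSetObjEquiv (TopCat.of X) (Opposite.op (SimplexCategory.mk n))).symm σ)).symm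
  exact LinearMap.congr_fun this c

/-- Cycles. -/
def Cyc {X : Type} [TopologicalSpace X] : (n : ℕ) → SC n X → Prop
  | 0, _ => True
  | n + 1, z => bd n X z = 0

/-- Boundaries. -/
def Bdry {X : Type} [TopologicalSpace X] (n : ℕ) (z : SC n X) : Prop := ∃ w, bd n X w = z

/-- Vanishing homology. -/
def HZ (n : ℕ) (X : Type) [TopologicalSpace X] : Prop := ∀ z : SC n X, Cyc n z → Bdry n z

lemma cyc_iff_cat {X : Type} [TopologicalSpace X] (n : ℕ) (z : SC n X) :
    Cyc n z ↔ (singularChainComplex (TopCat.of X)).d n ((ComplexShape.down ℕ).next n)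
      (toCat n X z) = 0 := by
  cases n with
  | zero =>
    simp only [Cyc, true_iff]
    rw [HomologicalComplex.shape]
    · rfl
    · simp
  | succ n =>
    have h : (ComplexShape.down ℕ).next (n + 1) = n := ChainComplex.next_nat_succ n
    rw [h, ← toCat_bd]
    simp [Cyc]

lemma bdry_iff_cat {X : Type} [TopologicalSpace X] (n : ℕ) (z : SC n X) :
    Bdry n z ↔ ∃ w, (singularChainComplex (TopCat.of X)).d ((ComplexShape.down ℕ).prev n) n w =
      toCat n X z := by
  have h : (ComplexShape.down ℕ).prev n = n + 1 := ChainComplex.prev ℕ n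
  rw [h]
  constructor
  · rintro ⟨w, rfl⟩
    exact ⟨toCat (n + 1) X w, (toCat_bd n X w).symm⟩
  · rintro ⟨w, hw⟩
    refine ⟨(toCat (n + 1) X).symm w, (toCat n X).injective ?_⟩
    rw [toCat_bd, LinearEquiv.apply_symm_apply, hw]

theorem hz_iff {X : Type} [TopologicalSpace X] (n : ℕ) :
    Subsingleton (singularHomology (TopCat.of X) n) ↔ HZ n X := by
  have h1 : Subsingleton (singularHomology (TopCat.of X) n) ↔
      (singularChainComplex (TopCat.of X)).ExactAt n := by
    rw [HomologicalComplex.exactAt_iff_isZero_homology, ModuleCat.isZero_iff_subsingleton]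
    rfl
  rw [h1, HomologicalComplex.exactAt_iff, ShortComplex.moduleCat_exact_iff]
  constructor
  · intro h z hz
    rw [bdry_iff_cat]
    exact h _ ((cyc_iff_cat n z).1 hz)
  · intro h x hx
    obtain ⟨z, rfl⟩ := (toCat n X).surjective x
    exact (bdry_iff_cat n z).1 (h z ((cyc_iff_cat n z).2 hx))

lemma homotopy_apply {K L : ChainComplex (ModuleCat ℤ) ℕ} {f g : K ⟶ L} (h : Homotopy f g)
    (n : ℕ) (x : K.X n) (hx : K.d n ((ComplexShape.down ℕ).next n) x = 0) :
    ∃ w, L.d ((ComplexShape.down ℕ).prev n) n w = f.f n x - g.f n x := by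
  have hc := h.comm n
  refine ⟨h.hom n _ x, ?_⟩
  rw [hc]
  simp [dNext, prevD, hx]

lemma pf_homotopic {X Y : Type} [TopologicalSpace X] [TopologicalSpace Y]
    {f g : C(X, Y)} (H : f.Homotopic g) (n : ℕ) (z : SC n X) (hz : Cyc n z) :
    Bdry n (pf n f z - pf n g z) := by
  obtain ⟨H⟩ := H
  have K : TopCat.Homotopy (TopCat.ofHom f) (TopCat.ofHom g) := H
  have h : Homotopy (sccMap f) (sccMap g) :=
    (K.toSSet.toSimplicialObjectHomotopy.whiskerRight (ModuleCat.free ℤ)).toChainHomotopy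
  rw [bdry_iff_cat, map_sub, toCat_pf, toCat_pf]
  exact homotopy_apply h n _ ((cyc_iff_cat n z).1 hz)

end KEq


namespace KEq

section Tuples

/-- Chains of tuples (augmented). -/
abbrev TC (p : ℕ) (E : Type) : Type := (Fin p → E) →₀ ℤ

variable {E E' : Type}

/-- Boundary of tuples. -/
noncomputable def td (p : ℕ) : TC (p + 1) E →ₗ[ℤ] TC p E :=
  Finsupp.linearCombination ℤ (fun v : Fin (p + 1) → E =>
    ∑ j : Fin (p + 1), ((-1 : ℤ) ^ (j : ℕ)) •
      Finsupp.single (fun i => v (j.succAbove i)) (1 : ℤ))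

/-- Cone operator. -/
noncomputable def cone (p : ℕ) (b : E) : TC p E →ₗ[ℤ] TC (p + 1) E :=
  Finsupp.lmapDomain ℤ ℤ (fun v => (Fin.cons b v : Fin (p + 1) → E))

/-- Pushforward of tuples. -/
noncomputable def tm (p : ℕ) (g : E → E') : TC p E →ₗ[ℤ] TC p E' :=
  Finsupp.lmapDomain ℤ ℤ (fun v i => g (v i))

lemma td_single (p : ℕ) (v : Fin (p + 1) → E) : td p (Finsupp.single v 1) =
    ∑ j : Fin (p + 1), ((-1 : ℤ) ^ (j : ℕ)) •
      Finsupp.single (fun i => v (j.succAbove i)) (1 : ℤ) := by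
  simp [td]

@[simp] lemma cone_single (p : ℕ) (b : E) (v : Fin p → E) (a : ℤ) :
    cone p b (Finsupp.single v a) = Finsupp.single (Fin.cons b v : Fin (p + 1) → E) a := by
  simp [cone]

@[simp] lemma tm_single (p : ℕ) (g : E → E') (v : Fin p → E) (a : ℤ) :
    tm p g (Finsupp.single v a) = Finsupp.single (fun i => g (v i)) a := by
  simp [tm]

lemma tc_induction {p : ℕ} {M : Type} [AddCommGroup M] {f g : TC p E →ₗ[ℤ] M}
    (h : ∀ v, f (Finsupp.single v 1) = g (Finsupp.single v 1)) (c : TC p E) : f c = g c := by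
  have : f = g := by
    ext1 v
    apply LinearMap.ext_ring
    simpa using h v
  rw [this]

lemma td_cone_zero (b : E) (c : TC 0 E) : td 0 (cone 0 b c) = c := by
  refine tc_induction (f := td 0 ∘ₗ cone 0 b) (g := LinearMap.id) (fun v => ?_) c
  simp only [LinearMap.comp_apply, cone_single, td_single, LinearMap.id_apply]
  simp only [Nat.reduceAdd, Finset.univ_unique, Fin.default_eq_zero, Finset.sum_singleton]
  simp

lemma td_cone (p : ℕ) (b : E) (c : TC (p + 1) E) :
    td (p + 1) (cone (p + 1) b c) = c - cone p b (td p c) := by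
  refine tc_induction (f := td (p + 1) ∘ₗ cone (p + 1) b) (g := LinearMap.id - cone p b ∘ₗ td p)
    (fun v => ?_) c
  simp only [LinearMap.comp_apply, cone_single, td_single, LinearMap.id_apply, LinearMap.sub_apply,
    map_sum, map_zsmul]
  rw [Fin.sum_univ_succ, sub_eq_add_neg, ← Finset.sum_neg_distrib]
  congr 1
  · simp
  · refine Finset.sum_congr rfl fun j _ => ?_
    rw [← neg_smul]
    congr 1
    · simp [pow_succ]
    · congr 1
      ext i
      refine Fin.cases ?_ (fun i => ?_) i
      · simp
      · simp

lemma td_td (p : ℕ) (c : TC (p + 2) E) : td p (td (p + 1) c) = 0 := by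
  induction p with
  | zero =>
    refine tc_induction (f := td 0 ∘ₗ td 1) (g := 0) (fun v => ?_) c
    have : (Finsupp.single v 1 : TC 2 E) = cone 1 (v 0) (Finsupp.single (Fin.tail v) 1) := by
      simp
    simp only [LinearMap.comp_apply, LinearMap.zero_apply]
    rw [this, td_cone, map_sub, td_cone_zero, sub_self]
  | succ p ih =>
    refine tc_induction (f := td (p + 1) ∘ₗ td (p + 2)) (g := 0) (fun v => ?_) c
    have : (Finsupp.single v 1 : TC (p + 3) E) =
        cone (p + 2) (v 0) (Finsupp.single (Fin.tail v) 1) := by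
      simp
    simp only [LinearMap.comp_apply, LinearMap.zero_apply]
    rw [this, td_cone, map_sub, td_cone, ih]
    simp

variable (bar : (p : ℕ) → (Fin p → E) → E) (bar' : (p : ℕ) → (Fin p → E') → E')

/-- Subdivision of tuples. -/
noncomputable def tsub : (p : ℕ) → TC p E →ₗ[ℤ] TC p E
  | 0 => LinearMap.id
  | p + 1 => Finsupp.linearCombination ℤ (fun v =>
      cone p (bar (p + 1) v) (tsub p (td p (Finsupp.single v 1))))

/-- The chain homotopy. -/
noncomputable def tht : (p : ℕ) → TC p E →ₗ[ℤ] TC (p + 1) E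
  | 0 => 0
  | p + 1 => Finsupp.linearCombination ℤ (fun v =>
      cone (p + 1) (bar (p + 1) v) (Finsupp.single v 1 - tht p (td p (Finsupp.single v 1))))

lemma tsub_single (p : ℕ) (v : Fin (p + 1) → E) : tsub bar (p + 1) (Finsupp.single v 1) =
      cone p (bar (p + 1) v) (tsub bar p (td p (Finsupp.single v 1))) := by
  simp [tsub]

lemma tht_single (p : ℕ) (v : Fin (p + 1) → E) : tht bar (p + 1) (Finsupp.single v 1) =
      cone (p + 1) (bar (p + 1) v)
        (Finsupp.single v 1 - tht bar p (td p (Finsupp.single v 1))) := by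
  simp [tht]

lemma td_tsub (p : ℕ) (c : TC (p + 1) E) :
    td p (tsub bar (p + 1) c) = tsub bar p (td p c) := by
  induction p with
  | zero =>
    refine tc_induction (f := td 0 ∘ₗ tsub bar 1) (g := tsub bar 0 ∘ₗ td 0) (fun v => ?_) c
    simp only [LinearMap.comp_apply]
    rw [tsub_single, td_cone_zero]
  | succ p ih =>
    refine tc_induction (f := td (p + 1) ∘ₗ tsub bar (p + 2))
      (g := tsub bar (p + 1) ∘ₗ td (p + 1)) (fun v => ?_) c
    simp only [LinearMap.comp_apply]
    rw [tsub_single, td_cone, ih, td_td]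
    simp

lemma td_tht_zero (c : TC 0 E) : td 0 (tht bar 0 c) = c - tsub bar 0 c := by
  simp [tht, tsub]

lemma td_tht (p : ℕ) (c : TC (p + 1) E) :
    td (p + 1) (tht bar (p + 1) c) = c - tsub bar (p + 1) c - tht bar p (td p c) := by
  induction p with
  | zero =>
    refine tc_induction (f := td 1 ∘ₗ tht bar 1)
      (g := LinearMap.id - tsub bar 1 - tht bar 0 ∘ₗ td 0) (fun v => ?_) c
    simp only [LinearMap.comp_apply, LinearMap.sub_apply, LinearMap.id_apply]
    rw [tht_single, td_cone, map_sub, td_tht_zero, sub_sub_cancel, tsub_single]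
    abel
  | succ p ih =>
    refine tc_induction (f := td (p + 2) ∘ₗ tht bar (p + 2))
      (g := LinearMap.id - tsub bar (p + 2) - tht bar (p + 1) ∘ₗ td (p + 1)) (fun v => ?_) c
    simp only [LinearMap.comp_apply, LinearMap.sub_apply, LinearMap.id_apply]
    rw [tht_single, td_cone, map_sub, ih, td_td, tsub_single]
    simp
    abel

lemma td_tm (p : ℕ) (g : E → E') (c : TC (p + 1) E) : td p (tm (p + 1) g c) = tm p g (td p c) := by
  refine tc_induction (f := td p ∘ₗ tm (p + 1) g) (g := tm p g ∘ₗ td p) (fun v => ?_) c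
  simp only [LinearMap.comp_apply, tm_single, td_single, map_sum, map_zsmul]

lemma cone_tm (p : ℕ) (g : E → E') (b : E) (c : TC p E) :
    cone p (g b) (tm p g c) = tm (p + 1) g (cone p b c) := by
  refine tc_induction (f := cone p (g b) ∘ₗ tm p g) (g := tm (p + 1) g ∘ₗ cone p b) (fun v => ?_) c
  simp only [LinearMap.comp_apply, tm_single, cone_single]
  congr 1
  ext i
  refine Fin.cases ?_ (fun i => ?_) i <;> simp

lemma tsub_tm (g : E → E') (hg : ∀ p (v : Fin (p + 1) → E), g (bar (p + 1) v) = bar' (p + 1) (fun i => g (v i)))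
    (p : ℕ) (c : TC p E) : tsub bar' p (tm p g c) = tm p g (tsub bar p c) := by
  induction p with
  | zero => rfl
  | succ p ih =>
    refine tc_induction (f := tsub bar' (p + 1) ∘ₗ tm (p + 1) g)
      (g := tm (p + 1) g ∘ₗ tsub bar (p + 1)) (fun v => ?_) c
    simp only [LinearMap.comp_apply]
    rw [tsub_single, ← cone_tm, ← ih, ← td_tm, tm_single, hg, tsub_single]

lemma tht_tm (g : E → E') (hg : ∀ p (v : Fin (p + 1) → E), g (bar (p + 1) v) = bar' (p + 1) (fun i => g (v i)))
    (p : ℕ) (c : TC p E) : tht bar' p (tm p g c) = tm (p + 1) g (tht bar p c) := by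
  induction p with
  | zero => simp [tht]
  | succ p ih =>
    refine tc_induction (f := tht bar' (p + 1) ∘ₗ tm (p + 1) g)
      (g := tm (p + 2) g ∘ₗ tht bar (p + 1)) (fun v => ?_) c
    simp only [LinearMap.comp_apply]
    rw [tht_single, ← cone_tm, map_sub, ← ih, ← td_tm, tm_single, hg, tht_single]

end Tuples

end KEq


namespace KEq

/-- The affine simplex spanned by a tuple of points. -/
noncomputable def aff {p n : ℕ} (v : Fin (p + 1) → stdSimplex ℝ (Fin (n + 1))) :
    C(stdSimplex ℝ (Fin (p + 1)), stdSimplex ℝ (Fin (n + 1))) where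
  toFun t := ⟨∑ j, t.1 j • (v j).1, (convex_stdSimplex ℝ _).sum_mem (fun j _ => t.2.1 j) t.2.2
    (fun j _ => (v j).2)⟩
  continuous_toFun := by
    apply Continuous.subtype_mk
    exact continuous_finsetSum _ fun j _ =>
      ((continuous_apply j).comp continuous_subtype_val).smul continuous_const

lemma aff_coe {p n : ℕ} (v : Fin (p + 1) → stdSimplex ℝ (Fin (n + 1))) (t) :
    (aff v t).1 = ∑ j, t.1 j • (v j).1 := rfl

lemma aff_vertex_apply {p n : ℕ} (v : Fin (p + 1) → stdSimplex ℝ (Fin (n + 1))) (i) :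
    aff v (stdSimplex.vertex i) = v i := by
  apply Subtype.ext
  rw [aff_coe]
  simp [Pi.single_apply]

lemma aff_vertex (n : ℕ) : aff (fun i : Fin (n + 1) => stdSimplex.vertex (S := ℝ) i) =
    ContinuousMap.id _ := by
  ext t i
  change (aff _ t).1 i = t.1 i
  rw [aff_coe]
  simp [Pi.single_apply, Finset.sum_apply]

lemma aff_comp {p q n : ℕ} (v : Fin (p + 1) → stdSimplex ℝ (Fin (n + 1)))
    (w : Fin (q + 1) → stdSimplex ℝ (Fin (p + 1))) :
    (aff v).comp (aff w) = aff (fun i => aff v (w i)) := by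
  ext1 t
  apply Subtype.ext
  simp only [ContinuousMap.comp_apply, aff_coe, Finset.sum_apply, Pi.smul_apply, Finset.sum_smul,
    Finset.smul_sum, smul_eq_mul, mul_smul]
  rw [Finset.sum_comm]

lemma smap_eq_aff {p n : ℕ} (f : Fin (p + 1) → Fin (n + 1)) :
    smap f = aff (fun i => stdSimplex.vertex (f i)) := by
  classical
  ext t i
  change FunOnFinite.linearMap ℝ ℝ f t.1 i = (aff _ t).1 i
  rw [aff_coe, FunOnFinite.linearMap_apply_apply]
  simp [Pi.single_apply, Finset.sum_apply, Finset.sum_filter, eq_comm]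

lemma aff_smap {p q n : ℕ} (v : Fin (p + 1) → stdSimplex ℝ (Fin (n + 1)))
    (f : Fin (q + 1) → Fin (p + 1)) : (aff v).comp (smap f) = aff (fun i => v (f i)) := by
  rw [smap_eq_aff, aff_comp]
  simp only [aff_vertex_apply]

/-- Barycenters. -/
noncomputable def bar (n : ℕ) : (p : ℕ) → (Fin p → stdSimplex ℝ (Fin (n + 1))) →
    stdSimplex ℝ (Fin (n + 1))
  | 0, _ => stdSimplex.vertex 0
  | _ + 1, v => aff v stdSimplex.barycenter

lemma aff_bar {m n : ℕ} (w : Fin (m + 1) → stdSimplex ℝ (Fin (n + 1))) (p : ℕ)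
    (v : Fin (p + 1) → stdSimplex ℝ (Fin (m + 1))) :
    aff w (bar m (p + 1) v) = bar n (p + 1) (fun i => aff w (v i)) := by
  simp only [bar]
  rw [← aff_comp]
  rfl

section Real

variable {X Y : Type} [TopologicalSpace X] [TopologicalSpace Y]

/-- Realization of tuple chains. -/
noncomputable def re (p : ℕ) {n : ℕ} (σ : C(stdSimplex ℝ (Fin (n + 1)), X)) :
    TC (p + 1) (stdSimplex ℝ (Fin (n + 1))) →ₗ[ℤ] SC p X :=
  Finsupp.lmapDomain ℤ ℤ (fun v => σ.comp (aff v))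

@[simp] lemma re_single (p : ℕ) {n : ℕ} (σ : C(stdSimplex ℝ (Fin (n + 1)), X)) (v) (a : ℤ) :
    re p σ (Finsupp.single v a) = Finsupp.single (σ.comp (aff v)) a := by
  simp [re]

/-- The fundamental tuple. -/
noncomputable def fund (n : ℕ) : TC (n + 1) (stdSimplex ℝ (Fin (n + 1))) :=
  Finsupp.single (fun i => stdSimplex.vertex i) 1

lemma re_fund {n : ℕ} (σ : C(stdSimplex ℝ (Fin (n + 1)), X)) :
    re n σ (fund n) = Finsupp.single σ 1 := by
  rw [fund, re_single, aff_vertex, ContinuousMap.comp_id]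

lemma tm_fund {m n : ℕ} (w : Fin (m + 1) → stdSimplex ℝ (Fin (n + 1))) :
    tm (m + 1) (aff w) (fund m) = Finsupp.single w 1 := by
  rw [fund, tm_single]
  simp only [aff_vertex_apply]

lemma re_comp (p : ℕ) {m n : ℕ} (σ : C(stdSimplex ℝ (Fin (n + 1)), X))
    (w : Fin (m + 1) → stdSimplex ℝ (Fin (n + 1))) (c) :
    re p (σ.comp (aff w)) c = re p σ (tm (p + 1) (aff w) c) := by
  refine tc_induction (f := re p (σ.comp (aff w))) (g := re p σ ∘ₗ tm (p + 1) (aff w))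
    (fun v => ?_) c
  simp only [LinearMap.comp_apply, re_single, tm_single, ContinuousMap.comp_assoc, aff_comp]

lemma bd_re (p : ℕ) {n : ℕ} (σ : C(stdSimplex ℝ (Fin (n + 1)), X)) (c) :
    bd p X (re (p + 1) σ c) = re p σ (td (p + 1) c) := by
  refine tc_induction (f := bd p X ∘ₗ re (p + 1) σ) (g := re p σ ∘ₗ td (p + 1))
    (fun v => ?_) c
  simp only [LinearMap.comp_apply, re_single, bd_single, td_single, map_sum, map_zsmul,
    ContinuousMap.comp_assoc, aff_smap]

/-- Subdivision. -/
noncomputable def ssub (n : ℕ) (X : Type) [TopologicalSpace X] : SC n X →ₗ[ℤ] SC n X :=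
  Finsupp.linearCombination ℤ (fun σ => re n σ (tsub (bar n) (n + 1) (fund n)))

/-- Subdivision homotopy. -/
noncomputable def sht (n : ℕ) (X : Type) [TopologicalSpace X] : SC n X →ₗ[ℤ] SC (n + 1) X :=
  Finsupp.linearCombination ℤ (fun σ => re (n + 1) σ (tht (bar n) (n + 1) (fund n)))

lemma ssub_single (n : ℕ) (σ : C(stdSimplex ℝ (Fin (n + 1)), X)) :
    ssub n X (Finsupp.single σ 1) = re n σ (tsub (bar n) (n + 1) (fund n)) := by
  simp [ssub]

lemma sht_single (n : ℕ) (σ : C(stdSimplex ℝ (Fin (n + 1)), X)) :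
    sht n X (Finsupp.single σ 1) = re (n + 1) σ (tht (bar n) (n + 1) (fund n)) := by
  simp [sht]

lemma ssub_re (p : ℕ) {n : ℕ} (σ : C(stdSimplex ℝ (Fin (n + 1)), X)) (c) :
    ssub p X (re p σ c) = re p σ (tsub (bar n) (p + 1) c) := by
  refine tc_induction (f := ssub p X ∘ₗ re p σ) (g := re p σ ∘ₗ tsub (bar n) (p + 1))
    (fun v => ?_) c
  simp only [LinearMap.comp_apply, re_single, ssub_single]
  rw [re_comp, ← tsub_tm (bar p) (bar n) (aff v) (aff_bar v), tm_fund]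

lemma sht_re (p : ℕ) {n : ℕ} (σ : C(stdSimplex ℝ (Fin (n + 1)), X)) (c) :
    sht p X (re p σ c) = re (p + 1) σ (tht (bar n) (p + 1) c) := by
  refine tc_induction (f := sht p X ∘ₗ re p σ) (g := re (p + 1) σ ∘ₗ tht (bar n) (p + 1))
    (fun v => ?_) c
  simp only [LinearMap.comp_apply, re_single, sht_single]
  rw [re_comp, ← tht_tm (bar p) (bar n) (aff v) (aff_bar v), tm_fund]

lemma sc_induction {n : ℕ} {M : Type} [AddCommGroup M] {f g : SC n X →ₗ[ℤ] M}
    (h : ∀ σ : C(stdSimplex ℝ (Fin (n + 1)), X), f (re n σ (fund n)) = g (re n σ (fund n)))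
    (c : SC n X) : f c = g c := by
  have : f = g := by
    ext1 v
    apply LinearMap.ext_ring
    simpa [re_fund] using h v
  rw [this]

lemma bd_bd (n : ℕ) (c : SC (n + 2) X) : bd n X (bd (n + 1) X c) = 0 := by
  refine sc_induction (f := bd n X ∘ₗ bd (n + 1) X) (g := 0) (fun σ => ?_) c
  simp only [LinearMap.comp_apply, bd_re, td_td, map_zero, LinearMap.zero_apply]

lemma bd_ssub (n : ℕ) (c : SC (n + 1) X) : bd n X (ssub (n + 1) X c) = ssub n X (bd n X c) := by
  refine sc_induction (f := bd n X ∘ₗ ssub (n + 1) X) (g := ssub n X ∘ₗ bd n X) (fun σ => ?_) c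
  simp only [LinearMap.comp_apply, bd_re, ssub_re, td_tsub]

lemma bd_sht_zero (c : SC 0 X) : bd 0 X (sht 0 X c) = c - ssub 0 X c := by
  refine sc_induction (f := bd 0 X ∘ₗ sht 0 X) (g := LinearMap.id - ssub 0 X) (fun σ => ?_) c
  simp only [LinearMap.comp_apply, LinearMap.sub_apply, LinearMap.id_apply]
  have h0 : tht (bar 0) 0 (td 0 (fund 0)) = 0 := rfl
  rw [sht_re, bd_re, ssub_re, td_tht, h0, sub_zero, map_sub]

lemma bd_sht (n : ℕ) (c : SC (n + 1) X) : bd (n + 1) X (sht (n + 1) X c) =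
    c - ssub (n + 1) X c - sht n X (bd n X c) := by
  refine sc_induction (f := bd (n + 1) X ∘ₗ sht (n + 1) X)
    (g := LinearMap.id - ssub (n + 1) X - sht n X ∘ₗ bd n X) (fun σ => ?_) c
  simp only [LinearMap.comp_apply, LinearMap.sub_apply, LinearMap.id_apply]
  simp only [sht_re, bd_re, ssub_re, td_tht, map_sub]

lemma pf_re (p : ℕ) {n : ℕ} (f : C(X, Y)) (σ : C(stdSimplex ℝ (Fin (n + 1)), X)) (c) :
    pf p f (re p σ c) = re p (f.comp σ) c := by
  refine tc_induction (f := pf p f ∘ₗ re p σ) (g := re p (f.comp σ)) (fun v => ?_) c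
  simp [ContinuousMap.comp_assoc]

lemma pf_ssub (n : ℕ) (f : C(X, Y)) (c : SC n X) : pf n f (ssub n X c) = ssub n Y (pf n f c) := by
  refine sc_induction (f := pf n f ∘ₗ ssub n X) (g := ssub n Y ∘ₗ pf n f) (fun σ => ?_) c
  simp only [LinearMap.comp_apply, ssub_re, pf_re]

lemma Bdry.add {n : ℕ} {a b : SC n X} (ha : Bdry n a) (hb : Bdry n b) : Bdry n (a + b) := by
  obtain ⟨u, rfl⟩ := ha
  obtain ⟨v, rfl⟩ := hb
  exact ⟨u + v, map_add _ _ _⟩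

lemma Bdry.neg {n : ℕ} {a : SC n X} (ha : Bdry n a) : Bdry n (-a) := by
  obtain ⟨u, rfl⟩ := ha
  exact ⟨-u, map_neg _ _⟩

lemma Bdry.sub {n : ℕ} {a b : SC n X} (ha : Bdry n a) (hb : Bdry n b) : Bdry n (a - b) := by
  rw [sub_eq_add_neg]
  exact ha.add hb.neg

lemma Bdry.pf {n : ℕ} {a : SC n X} (ha : Bdry n a) (f : C(X, Y)) : Bdry n (pf n f a) := by
  obtain ⟨u, rfl⟩ := ha
  exact ⟨KEq.pf _ f u, bd_pf _ _ _⟩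

lemma Bdry.cyc {n : ℕ} {a : SC n X} (ha : Bdry n a) : Cyc n a := by
  obtain ⟨u, rfl⟩ := ha
  cases n with
  | zero => trivial
  | succ n => exact bd_bd _ _

lemma Cyc.add {n : ℕ} {a b : SC n X} (ha : Cyc n a) (hb : Cyc n b) : Cyc n (a + b) := by
  cases n with
  | zero => trivial
  | succ n => simp only [Cyc] at *; rw [map_add, ha, hb, add_zero]

lemma Cyc.sub {n : ℕ} {a b : SC n X} (ha : Cyc n a) (hb : Cyc n b) : Cyc n (a - b) := by
  cases n with
  | zero => trivial
  | succ n => simp only [Cyc] at *; rw [map_sub, ha, hb, sub_zero]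

lemma Cyc.pf {n : ℕ} {a : SC n X} (ha : Cyc n a) (f : C(X, Y)) : Cyc n (pf n f a) := by
  cases n with
  | zero => trivial
  | succ n => simp only [Cyc] at *; rw [bd_pf, ha, map_zero]

lemma Cyc.ssub {n : ℕ} {a : SC n X} (ha : Cyc n a) : Cyc n (ssub n X a) := by
  cases n with
  | zero => trivial
  | succ n => simp only [Cyc] at *; rw [bd_ssub, ha, map_zero]

lemma Cyc.bdry_sub {n : ℕ} {a : SC n X} (ha : Cyc n a) : Bdry n (a - KEq.ssub n X a) := by
  refine ⟨sht n X a, ?_⟩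
  cases n with
  | zero => exact bd_sht_zero a
  | succ n => simp only [Cyc] at *; rw [bd_sht, ha, map_zero, sub_zero]

lemma Cyc.iter {n : ℕ} {a : SC n X} (ha : Cyc n a) (N : ℕ) :
    Cyc n ((KEq.ssub n X)^[N] a) ∧ Bdry n (a - (KEq.ssub n X)^[N] a) := by
  induction N with
  | zero => exact ⟨ha, 0, by simp⟩
  | succ N ih =>
    rw [Function.iterate_succ_apply']
    refine ⟨ih.1.ssub, ?_⟩
    have := ih.2.add ih.1.bdry_sub
    simpa using this

lemma bd_iter (n : ℕ) (c : SC (n + 1) X) (N : ℕ) : bd n X ((ssub (n + 1) X)^[N] c) =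
    (ssub n X)^[N] (bd n X c) := by
  induction N with
  | zero => rfl
  | succ N ih => rw [Function.iterate_succ_apply', Function.iterate_succ_apply', bd_ssub, ih]

lemma pf_iter (n : ℕ) (f : C(X, Y)) (c : SC n X) (N : ℕ) : pf n f ((ssub n X)^[N] c) =
    (ssub n Y)^[N] (pf n f c) := by
  induction N with
  | zero => rfl
  | succ N ih => rw [Function.iterate_succ_apply', Function.iterate_succ_apply', pf_ssub, ih]

lemma re_iter (p : ℕ) {n : ℕ} (σ : C(stdSimplex ℝ (Fin (n + 1)), X)) (c) (N : ℕ) :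
    (ssub p X)^[N] (re p σ c) = re p σ ((tsub (bar n) (p + 1))^[N] c) := by
  induction N with
  | zero => rfl
  | succ N ih => rw [Function.iterate_succ_apply', Function.iterate_succ_apply', ih, ssub_re]

end Real

end KEq


namespace KEq

lemma dist_aff_le {p n : ℕ} (c : stdSimplex ℝ (Fin (n + 1)))
    (v : Fin (p + 1) → stdSimplex ℝ (Fin (n + 1))) (t) :
    dist c (aff v t) ≤ ∑ j, t.1 j * dist c (v j) := by
  rw [Subtype.dist_eq, dist_eq_norm, aff_coe]
  have h : c.1 - ∑ j, t.1 j • (v j).1 = ∑ j, t.1 j • (c.1 - (v j).1) := by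
    simp only [smul_sub, Finset.sum_sub_distrib]
    rw [← Finset.sum_smul, t.2.2, one_smul]
  rw [h]
  refine (norm_sum_le _ _).trans (Finset.sum_le_sum fun j _ => ?_)
  rw [norm_smul, Real.norm_of_nonneg (t.2.1 j), Subtype.dist_eq, dist_eq_norm]

lemma dist_aff_le' {p n : ℕ} (c : stdSimplex ℝ (Fin (n + 1)))
    (v : Fin (p + 1) → stdSimplex ℝ (Fin (n + 1))) (t) (R : ℝ) (h : ∀ j, dist c (v j) ≤ R) :
    dist c (aff v t) ≤ R := by
  refine (dist_aff_le c v t).trans ?_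
  calc _ ≤ ∑ j, t.1 j * R := Finset.sum_le_sum fun j _ =>
        mul_le_mul_of_nonneg_left (h j) (t.2.1 j)
    _ = R := by rw [← Finset.sum_mul, t.2.2, one_mul]

lemma dist_bar_le {p n : ℕ} (hp : p ≤ n) (v : Fin (p + 1) → stdSimplex ℝ (Fin (n + 1)))
    (D : ℝ) (hD : 0 ≤ D) (h : ∀ i j, dist (v i) (v j) ≤ D) (i) :
    dist (v i) (bar n (p + 1) v) ≤ (n / (n + 1) : ℝ) * D := by
  refine (dist_aff_le _ v _).trans ?_
  have hb : ∀ j, (stdSimplex.barycenter (𝕜 := ℝ) (X := Fin (p + 1))).1 j = 1 / ((p : ℝ) + 1) := by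
    intro j
    have := stdSimplex.barycenter_apply (𝕜 := ℝ) (X := Fin (p + 1)) j
    rw [this]; simp
  simp only [hb]
  rw [← Finset.mul_sum, ← Finset.add_sum_erase _ _ (Finset.mem_univ i), dist_self, zero_add]
  have h1 : ∑ j ∈ Finset.univ.erase i, dist (v i) (v j) ≤ p * D := by
    refine (Finset.sum_le_card_nsmul _ _ D (fun j _ => h i j)).trans ?_
    simp
  have h2 : (p : ℝ) / (p + 1) ≤ n / (n + 1) := by
    have : (p : ℝ) ≤ n := by exact_mod_cast hp
    rw [div_le_div_iff₀ (by positivity) (by positivity)]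
    nlinarith
  calc _ ≤ 1 / ((p : ℝ) + 1) * (p * D) := by gcongr
    _ = (p : ℝ) / (p + 1) * D := by ring
    _ ≤ _ := by gcongr

/-- Tuples produced by subdividing the tuple `v`. -/
def fine (n p : ℕ) (D : ℝ) (v : Fin p → stdSimplex ℝ (Fin (n + 1))) :
    Set (Fin p → stdSimplex ℝ (Fin (n + 1))) :=
  {w | (∀ i j, dist (w i) (w j) ≤ (n / (n + 1) : ℝ) * D) ∧
    ∀ c R, (∀ j, dist c (v j) ≤ R) → ∀ i, dist c (w i) ≤ R}

lemma tsub_fine (n : ℕ) (D : ℝ) (hD : 0 ≤ D) (p : ℕ) (hp : p ≤ n + 1)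
    (v : Fin p → stdSimplex ℝ (Fin (n + 1))) (h : ∀ i j, dist (v i) (v j) ≤ D) :
    tsub (bar n) p (Finsupp.single v 1) ∈ Finsupp.supported ℤ ℤ (fine n p D v) := by
  induction p with
  | zero =>
    exact Finsupp.single_mem_supported _ _ ⟨fun i => i.elim0, fun _ _ _ i => i.elim0⟩
  | succ p ih =>
    have hr : (0 : ℝ) ≤ (n / (n + 1) : ℝ) * D := by positivity
    rw [tsub_single, td_single, map_sum, map_sum]
    refine Submodule.sum_mem _ fun j _ => ?_
    rw [map_zsmul, map_zsmul]
    refine Submodule.smul_mem _ _ ?_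
    have := ih (by omega) (fun i => v (j.succAbove i)) (fun _ _ => h _ _)
    have h2 : cone p (bar n (p + 1) v) (tsub (bar n) p (Finsupp.single (fun i => v (j.succAbove i)) 1)) ∈
      (Finsupp.supported ℤ ℤ (fine n p D (fun i => v (j.succAbove i)))).map
        (cone p (bar n (p + 1) v)) := ⟨_, this, rfl⟩
    rw [cone, Finsupp.lmapDomain_supported] at h2
    refine Finsupp.supported_mono ?_ h2
    rintro _ ⟨w, hw, rfl⟩
    have hb : ∀ i, dist (bar n (p + 1) v) (w i) ≤ (n / (n + 1) : ℝ) * D := fun i =>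
      hw.2 _ _ (fun j => by
        rw [dist_comm]; exact dist_bar_le (by omega) v D hD h _) i
    refine ⟨fun a b => ?_, fun c R hc a => ?_⟩
    · refine Fin.cases ?_ (fun a => ?_) a <;> refine Fin.cases ?_ (fun b => ?_) b
      · simpa using hr
      · simpa using hb b
      · simpa [dist_comm] using hb a
      · simpa using hw.1 a b
    · refine Fin.cases ?_ (fun a => ?_) a
      · simpa [bar] using dist_aff_le' c v stdSimplex.barycenter R hc
      · simpa using hw.2 c R (fun j => hc _) a

lemma tsub_iter_fine (n : ℕ) (D : ℝ) (hD : 0 ≤ D) (c : TC (n + 1) (stdSimplex ℝ (Fin (n + 1))))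
    (hc : c ∈ Finsupp.supported ℤ ℤ
      {w : Fin (n + 1) → stdSimplex ℝ (Fin (n + 1)) | ∀ i j, dist (w i) (w j) ≤ D}) (N : ℕ) :
    (tsub (bar n) (n + 1))^[N] c ∈ Finsupp.supported ℤ ℤ
      {w : Fin (n + 1) → stdSimplex ℝ (Fin (n + 1)) |
        ∀ i j, dist (w i) (w j) ≤ (n / (n + 1) : ℝ) ^ N * D} := by
  induction N with
  | zero => simpa using hc
  | succ N ih =>
    rw [Function.iterate_succ_apply']
    rw [Finsupp.supported_eq_span_single] at ih
    have := Submodule.mem_map_of_mem (f := tsub (bar n) (n + 1)) ih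
    rw [Submodule.map_span] at this
    refine (Submodule.span_le.2 ?_) this
    rintro _ ⟨_, ⟨w, hw, rfl⟩, rfl⟩
    refine Finsupp.supported_mono ?_ (tsub_fine n ((n / (n + 1) : ℝ) ^ N * D) (by positivity)
      (n + 1) le_rfl w hw)
    intro u hu
    refine fun i j => (hu.1 i j).trans (le_of_eq ?_)
    ring

section Small

variable {X : Type} [TopologicalSpace X]

/-- Chains contained in a subset. -/
def chin (n : ℕ) (A : Set X) : Submodule ℤ (SC n X) :=
  Finsupp.supported ℤ ℤ {σ | Set.range σ ⊆ A}

lemma small_single (n : ℕ) (A B : Set X) (hA : IsOpen A) (hB : IsOpen B) (hAB : A ∪ B = Set.univ)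
    (σ : C(stdSimplex ℝ (Fin (n + 1)), X)) : ∃ N, ∀ m ≥ N,
      (ssub n X)^[m] (Finsupp.single σ 1) ∈ chin n A ⊔ chin n B := by
  obtain ⟨δ, hδ, hL⟩ := lebesgue_number_lemma_of_metric (s := (Set.univ :
    Set (stdSimplex ℝ (Fin (n + 1))))) (c := fun b : Bool => σ ⁻¹' (if b then A else B))
    isCompact_univ (by rintro (_ | _) <;> simp [hA.preimage σ.continuous, hB.preimage σ.continuous])
    (by
      intro x _
      have : σ x ∈ A ∪ B := by rw [hAB]; trivial
      rcases this with h | h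
      · exact Set.mem_iUnion.2 ⟨true, by simpa using h⟩
      · exact Set.mem_iUnion.2 ⟨false, by simpa using h⟩)
  set D := Metric.diam (Set.univ : Set (stdSimplex ℝ (Fin (n + 1)))) with hDdef
  have hD : 0 ≤ D := Metric.diam_nonneg
  have hr0 : (0 : ℝ) ≤ n / (n + 1) := by positivity
  have hr1 : (n / (n + 1) : ℝ) < 1 := by rw [div_lt_one (by positivity)]; linarith
  have hlim : Filter.Tendsto (fun m : ℕ => (n / (n + 1) : ℝ) ^ m * D) Filter.atTop (nhds 0) := by
    simpa using (tendsto_pow_atTop_nhds_zero_of_lt_one hr0 hr1).mul_const D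
  obtain ⟨N, hN⟩ := Filter.eventually_atTop.1 (hlim.eventually_lt_const hδ)
  refine ⟨N, fun m hm => ?_⟩
  have hf := tsub_iter_fine n D hD (fund n) (Finsupp.single_mem_supported _ _ fun i j =>
    Metric.dist_le_diam_of_mem isCompact_univ.isBounded trivial trivial) m
  rw [← re_fund, re_iter]
  rw [Finsupp.supported_eq_span_single] at hf
  have := Submodule.mem_map_of_mem (f := re n σ) hf
  rw [Submodule.map_span] at this
  refine (Submodule.span_le.2 ?_) this
  rintro _ ⟨_, ⟨w, hw, rfl⟩, rfl⟩
  obtain ⟨b, hb⟩ := hL (w 0) trivial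
  have hsub : Set.range (σ.comp (aff w)) ⊆ (if b then A else B) := by
    rintro _ ⟨t, rfl⟩
    refine hb ?_
    rw [Metric.mem_ball, dist_comm]
    exact (dist_aff_le' _ w t _ (hw 0)).trans_lt (hN m hm)
  rw [re_single]
  cases b with
  | true => exact Submodule.mem_sup_left (Finsupp.single_mem_supported _ _ (by simpa using hsub))
  | false => exact Submodule.mem_sup_right (Finsupp.single_mem_supported _ _ (by simpa using hsub))

lemma iter_add (n : ℕ) (N : ℕ) (a b : SC n X) :
    (ssub n X)^[N] (a + b) = (ssub n X)^[N] a + (ssub n X)^[N] b := by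
  rw [← Module.End.coe_pow, map_add]

lemma iter_smul (n : ℕ) (N : ℕ) (r : ℤ) (b : SC n X) :
    (ssub n X)^[N] (r • b) = r • (ssub n X)^[N] b := by
  rw [← Module.End.coe_pow, map_smul]

lemma small_exists (n : ℕ) (A B : Set X) (hA : IsOpen A) (hB : IsOpen B) (hAB : A ∪ B = Set.univ)
    (c : SC n X) : ∃ N, ∀ m ≥ N, (ssub n X)^[m] c ∈ chin n A ⊔ chin n B := by
  induction c using Finsupp.induction_linear with
  | zero => exact ⟨0, fun m _ => by rw [← Module.End.coe_pow, map_zero]; exact zero_mem _⟩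
  | add f g hf hg =>
    obtain ⟨N, hN⟩ := hf
    obtain ⟨M, hM⟩ := hg
    refine ⟨max N M, fun m hm => ?_⟩
    rw [iter_add]
    exact add_mem (hN m (le_of_max_le_left hm)) (hM m (le_of_max_le_right hm))
  | single σ a =>
    obtain ⟨N, hN⟩ := small_single n A B hA hB hAB σ
    refine ⟨N, fun m hm => ?_⟩
    have : Finsupp.single σ a = a • Finsupp.single σ (1 : ℤ) := by simp
    rw [this, iter_smul]
    exact Submodule.smul_mem _ _ (hN m hm)

/-- The inclusion of a subset. -/
def inc (A : Set X) : C(A, X) := ⟨Subtype.val, continuous_subtype_val⟩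

/-- The inclusion between subsets. -/
def incl {A B : Set X} (h : A ⊆ B) : C(A, B) := ⟨Set.inclusion h, continuous_inclusion h⟩

lemma inc_incl {A B : Set X} (h : A ⊆ B) : (inc B).comp (incl h) = inc A := rfl

lemma pf_inc_mem (n : ℕ) (A : Set X) (c : SC n A) : pf n (inc A) c ∈ chin n A := by
  have h2 : pf n (inc A) c ∈ (Finsupp.supported ℤ ℤ Set.univ).map (pf n (inc A)) :=
    ⟨c, by simp [Finsupp.supported_univ], rfl⟩
  rw [pf, Finsupp.lmapDomain_supported] at h2
  refine Finsupp.supported_mono ?_ h2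
  rintro _ ⟨σ, _, rfl⟩ _ ⟨t, rfl⟩
  exact (σ t).2

lemma exists_lift (n : ℕ) (A : Set X) (c : SC n X) (hc : c ∈ chin n A) :
    ∃ c' : SC n A, pf n (inc A) c' = c := by
  rw [chin, Finsupp.supported_eq_span_single] at hc
  have : Submodule.span ℤ ((fun σ : C(stdSimplex ℝ (Fin (n + 1)), X) => Finsupp.single σ (1 : ℤ)) '' {σ | Set.range σ ⊆ A})
      ≤ LinearMap.range (pf n (inc A)) := by
    rw [Submodule.span_le]
    rintro _ ⟨σ, hσ, rfl⟩
    refine ⟨Finsupp.single ⟨fun t => ⟨σ t, hσ ⟨t, rfl⟩⟩, by fun_prop⟩ 1, ?_⟩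
    rw [pf_single]
    rfl
  exact this hc

lemma pf_inc_inj (n : ℕ) (A : Set X) : Function.Injective (pf n (inc A)) := by
  apply Finsupp.mapDomain_injective
  intro σ τ h
  ext t
  exact congrArg (fun f : C(_, X) => f t) h

lemma chin_inter (n : ℕ) (A B : Set X) (c : SC n X) (hA : c ∈ chin n A) (hB : c ∈ chin n B) :
    c ∈ chin n (A ∩ B) := by
  have : {σ : C(stdSimplex ℝ (Fin (n + 1)), X) | Set.range σ ⊆ A ∩ B} =
    {σ : C(stdSimplex ℝ (Fin (n + 1)), X) | Set.range σ ⊆ A} ∩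
      {σ : C(stdSimplex ℝ (Fin (n + 1)), X) | Set.range σ ⊆ B} := by ext; simp
  rw [chin, this, Finsupp.supported_inter]
  exact ⟨hA, hB⟩

end Small

end KEq


namespace KEq

section MV

variable {X Y Z : Type} [TopologicalSpace X] [TopologicalSpace Y] [TopologicalSpace Z]

/-- Injectivity on homology. -/
def Inj (i : ℕ) (f : C(X, Y)) : Prop := ∀ z : SC i X, Cyc i z → Bdry i (pf i f z) → Bdry i z

lemma Inj.of_comp {i : ℕ} {f : C(X, Y)} {g : C(Y, Z)} (h : Inj i (g.comp f)) : Inj i f := by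
  intro z hz hb
  refine h z hz ?_
  rw [pf_comp]
  exact hb.pf g

lemma HZ.inj {i : ℕ} (h : HZ i X) (f : C(X, Y)) : Inj i f := fun z hz _ => h z hz

lemma Inj.hz {i : ℕ} {f : C(X, Y)} (hf : Inj i f) (h : HZ i Y) : HZ i X :=
  fun z hz => hf z hz (h _ (hz.pf f))

lemma inj_of_leftInv {i : ℕ} (f : C(X, Y)) (g : C(Y, X))
    (h : (g.comp f).Homotopic (ContinuousMap.id X)) : Inj i f := by
  intro z hz hb
  have h1 := pf_homotopic h i z hz
  rw [pf_id, pf_comp] at h1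
  have := (hb.pf g).sub h1
  simpa using this

lemma HZ.of_dom {i : ℕ} (h : HZ i Y) (f : C(X, Y)) (g : C(Y, X))
    (hgf : (g.comp f).Homotopic (ContinuousMap.id X)) : HZ i X :=
  (inj_of_leftInv f g hgf).hz h

lemma HZ.of_homeo {i : ℕ} (h : HZ i Y) (e : X ≃ₜ Y) : HZ i X :=
  h.of_dom (e : C(X, Y)) (e.symm : C(Y, X)) (by
    have : (e.symm : C(Y, X)).comp (e : C(X, Y)) = ContinuousMap.id X := by ext x; simp
    rw [this])

lemma Bdry.of_iter {n : ℕ} {z : SC n X} (hz : Cyc n z) (N : ℕ) (h : Bdry n ((ssub n X)^[N] z)) :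
    Bdry n z := by
  have := (hz.iter N).2.add h
  simpa using this

lemma Cyc.of_inc {n : ℕ} {A : Set X} {c : SC n A} (h : Cyc n (KEq.pf n (inc A) c)) : Cyc n c := by
  cases n with
  | zero => trivial
  | succ n =>
    simp only [Cyc] at *
    rw [bd_pf] at h
    exact pf_inc_inj _ _ (by rw [h, map_zero])

variable (A B : Set X)

lemma mv_small (hA : IsOpen A) (hB : IsOpen B) (hAB : A ∪ B = Set.univ)
    (n : ℕ) (c : SC n X) : ∃ N, ∃ a : SC n A, ∃ b : SC n B,
    (ssub n X)^[N] c = pf n (inc A) a + pf n (inc B) b := by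
  obtain ⟨N, hN⟩ := small_exists n A B hA hB hAB c
  obtain ⟨a, ha, b, hb, h⟩ := Submodule.mem_sup.1 (hN N le_rfl)
  obtain ⟨a', rfl⟩ := exists_lift _ _ _ ha
  obtain ⟨b', rfl⟩ := exists_lift _ _ _ hb
  exact ⟨N, a', b', h.symm⟩

lemma mv_inter (n : ℕ) (a : SC n A) (b : SC n B) (h : pf n (inc A) a = pf n (inc B) b) :
    ∃ c : SC n (A ∩ B : Set X), pf n (incl Set.inter_subset_left) c = a ∧
      pf n (incl Set.inter_subset_right) c = b := by
  obtain ⟨c, hc⟩ := exists_lift n (A ∩ B) (pf n (inc A) a)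
    (chin_inter _ _ _ _ (pf_inc_mem _ _ _) (h ▸ pf_inc_mem _ _ _))
  refine ⟨c, pf_inc_inj _ _ ?_, pf_inc_inj _ _ ?_⟩
  · rw [← pf_comp, inc_incl, hc]
  · rw [← pf_comp, inc_incl, hc, h]

lemma mv_mid (hA : IsOpen A) (hB : IsOpen B) (hAB : A ∪ B = Set.univ)
    (i : ℕ) (h1 : HZ i (A ∩ B : Set X)) (h2 : HZ i X) : HZ i A := by
  intro z hz
  obtain ⟨w, hw⟩ := h2 _ (hz.pf (inc A))
  obtain ⟨N, a, b, hab⟩ := mv_small A B hA hB hAB (i + 1) w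
  refine Bdry.of_iter hz N ?_
  have h3 : bd i X ((ssub (i + 1) X)^[N] w) = pf i (inc A) ((ssub i A)^[N] z) := by
    rw [bd_iter, hw, pf_iter]
  rw [hab, map_add, bd_pf, bd_pf] at h3
  obtain ⟨c, hc1, hc2⟩ := mv_inter A B i ((ssub i A)^[N] z - bd i A a) (bd i B b) (by
    rw [map_sub, ← h3]; abel)
  have hcyc : Cyc i c := by
    apply Cyc.of_inc
    rw [← inc_incl Set.inter_subset_right, pf_comp, hc2]
    exact Cyc.pf (Bdry.cyc ⟨b, rfl⟩) _
  have h5 : Bdry i ((ssub i A)^[N] z - bd i A a) := hc1 ▸ (h1 c hcyc).pf _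
  have h6 := h5.add ⟨a, rfl⟩
  simpa using h6

lemma mv_split (hA : IsOpen A) (hB : IsOpen B) (hAB : A ∪ B = Set.univ)
    (i : ℕ) (hconn : ∀ j, j + 1 = i →
      Inj j (incl (Set.inter_subset_left : A ∩ B ⊆ A))) (z : SC i X) (hz : Cyc i z) :
    ∃ a : SC i A, ∃ b : SC i B, Cyc i a ∧ Cyc i b ∧
      Bdry i (z - (pf i (inc A) a + pf i (inc B) b)) := by
  obtain ⟨N, a, b, hab⟩ := mv_small A B hA hB hAB i z
  have h3 := (hz.iter N).2
  have h4 := (hz.iter N).1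
  rw [hab] at h3 h4
  cases i with
  | zero => exact ⟨a, b, trivial, trivial, h3⟩
  | succ j =>
    simp only [Cyc] at h4
    rw [map_add, bd_pf, bd_pf] at h4
    obtain ⟨c, hc1, hc2⟩ := mv_inter A B j (bd j A a) (-bd j B b) (by
      rw [map_neg]; exact eq_neg_of_add_eq_zero_left h4)
    have hcyc : Cyc j c := by
      apply Cyc.of_inc
      rw [← inc_incl Set.inter_subset_left, pf_comp, hc1]
      exact Cyc.pf (Bdry.cyc ⟨a, rfl⟩) _
    obtain ⟨e, he⟩ := hconn j rfl c hcyc (hc1 ▸ ⟨a, rfl⟩)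
    refine ⟨a - pf _ (incl Set.inter_subset_left) e, b + pf _ (incl Set.inter_subset_right) e,
      ?_, ?_, ?_⟩
    · simp only [Cyc]
      rw [map_sub, bd_pf, he, hc1, sub_self]
    · simp only [Cyc]
      rw [map_add, bd_pf, he, hc2, add_neg_cancel]
    · rw [map_sub, map_add, ← pf_comp, ← pf_comp, inc_incl, inc_incl]
      convert h3 using 2
      abel

lemma mv_conn (hA : IsOpen A) (hB : IsOpen B) (hAB : A ∪ B = Set.univ)
    (i : ℕ) (h1 : HZ i A) (h2 : HZ i B)
    (h3 : ∀ j, j + 1 = i → HZ j (A ∩ B : Set X)) : HZ i X := by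
  intro z hz
  obtain ⟨a, b, ha, hb, h⟩ := mv_split A B hA hB hAB i (fun j hj => (h3 j hj).inj _) z hz
  have := h.add (((h1 a ha).pf (inc A)).add ((h2 b hb).pf (inc B)))
  simpa using this

lemma mv_inj (hA : IsOpen A) (hB : IsOpen B) (hAB : A ∪ B = Set.univ)
    (i : ℕ) (p : C(X, Y)) (s : C(Y, (A ∩ B : Set X)))
    (hs : ∀ y, p (s y) = y) (h1 : Inj i (p.comp (inc A))) (h2 : Inj i (p.comp (inc B)))
    (h3 : ∀ j, j + 1 = i → Inj j (p.comp (inc (A ∩ B)))) : Inj i p := by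
  intro z hz hpz
  obtain ⟨a, b, ha, hb, h⟩ := mv_split A B hA hB hAB i
    (fun j hj => Inj.of_comp (g := p.comp (inc A)) (h3 j hj)) z hz
  have key : ∀ (C : Set X) (hC : A ∩ B ⊆ C) (h1 : Inj i (p.comp (inc C))) (a : SC i C)
    (ha : Cyc i a), Bdry i (pf i (inc C) a - pf i ((inc (A ∩ B)).comp s) (pf i (p.comp (inc C)) a)) := by
    intro C hC h1 a ha
    have := h1 (a - pf i ((incl hC).comp s) (pf i (p.comp (inc C)) a))
      (ha.sub ((ha.pf _).pf _)) (by
        rw [map_sub, ← pf_comp _ ((incl hC).comp s)]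
        have : (p.comp (inc C)).comp ((incl hC).comp s) = ContinuousMap.id Y := by
          ext y; exact hs y
        rw [this, pf_id, sub_self]
        exact ⟨0, map_zero _⟩)
    have := this.pf (inc C)
    rw [map_sub, ← pf_comp _ ((incl hC).comp s), ← ContinuousMap.comp_assoc, inc_incl] at this
    exact this
  have k1 := key A Set.inter_subset_left h1 a ha
  have k2 := key B Set.inter_subset_right h2 b hb
  have k3 := (h.pf p).pf ((inc (A ∩ B)).comp s)
  have k4 := hpz.pf ((inc (A ∩ B)).comp s)
  simp only [pf_comp, map_sub, map_add] at *
  have := (h.add (k1.add k2)).add (k4.sub k3)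
  convert this using 1
  abel

end MV

end KEq


namespace KEq

section GoodSpaces

variable {X Z : Type} [TopologicalSpace X] [TopologicalSpace Z]

lemma HZ.of_retract {i : ℕ} (h : HZ i Z) (f : X → Z) (g : Z → X) (hf : Continuous f)
    (hg : Continuous g) (hgf : ∀ x, g (f x) = x) : HZ i X :=
  h.of_dom ⟨f, hf⟩ ⟨g, hg⟩ (by
    have : (⟨g, hg⟩ : C(Z, X)).comp ⟨f, hf⟩ = ContinuousMap.id X := by ext x; exact hgf x
    rw [this])

lemma HZ.of_isEmpty (i : ℕ) [IsEmpty X] : HZ i X := by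
  intro z _
  have : z = 0 := by
    have : IsEmpty C(stdSimplex ℝ (Fin (i + 1)), X) := ⟨fun σ => isEmptyElim (σ (stdSimplex.vertex 0))⟩
    exact Subsingleton.elim _ _
  exact ⟨0, by rw [this, map_zero]⟩

lemma mv_mid_sets (A B : Set X) (hA : IsOpen A) (hB : IsOpen B) (i : ℕ)
    (h1 : HZ i (A ∩ B : Set X)) (h2 : HZ i (A ∪ B : Set X)) : HZ i A := by
  have h3 := mv_mid (X := (A ∪ B : Set X)) (Subtype.val ⁻¹' A) (Subtype.val ⁻¹' B)
    (hA.preimage continuous_subtype_val) (hB.preimage continuous_subtype_val)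
    (by ext ⟨x, hx⟩; simpa using hx) i
    (h1.of_retract (fun x => ⟨x.1.1, x.2.1, x.2.2⟩) (fun x => ⟨⟨x.1, Or.inl x.2.1⟩, x.2.1, x.2.2⟩)
      (by fun_prop) (by fun_prop) (fun x => rfl)) h2
  exact h3.of_retract (fun x => ⟨⟨x.1, Or.inl x.2⟩, x.2⟩) (fun x => ⟨x.1.1, x.2⟩)
      (by fun_prop) (by fun_prop) (fun x => rfl)

lemma mv_disj_sets (A B : Set X) (hA : IsOpen A) (hB : IsOpen B) (i : ℕ)
    (h0 : A ∩ B = ∅) (h1 : HZ i A) (h2 : HZ i B) : HZ i (A ∪ B : Set X) := by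
  refine mv_conn (X := (A ∪ B : Set X)) (Subtype.val ⁻¹' A) (Subtype.val ⁻¹' B)
    (hA.preimage continuous_subtype_val) (hB.preimage continuous_subtype_val)
    (by ext ⟨x, hx⟩; simpa using hx) i
    (h1.of_retract (fun x => ⟨x.1.1, x.2⟩) (fun x => ⟨⟨x.1, Or.inl x.2⟩, x.2⟩)
      (by fun_prop) (by fun_prop) (fun x => rfl))
    (h2.of_retract (fun x => ⟨x.1.1, x.2⟩) (fun x => ⟨⟨x.1, Or.inr x.2⟩, x.2⟩)
      (by fun_prop) (by fun_prop) (fun x => rfl)) ?_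
  intro j _
  have : IsEmpty ↑(Subtype.val ⁻¹' A ∩ Subtype.val ⁻¹' B : Set (A ∪ B : Set X)) := by
    refine ⟨fun x => ?_⟩
    have : x.1.1 ∈ A ∩ B := ⟨x.2.1, x.2.2⟩
    rw [h0] at this
    exact this
  exact HZ.of_isEmpty j

/-- Spaces whose product with anything concentrated in degrees divisible by `d` is again so. -/
def Good (d : ℕ) (X : Type) [TopologicalSpace X] : Prop :=
  ∀ (Y : Type) [TopologicalSpace Y], (∀ i, ¬ d ∣ i → HZ i Y) → ∀ i, ¬ d ∣ i → HZ i (Y × X)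

variable {d : ℕ}

lemma Good.of_dom (h : Good d Z) (f : C(X, Z)) (g : C(Z, X))
    (hgf : (g.comp f).Homotopic (ContinuousMap.id X)) : Good d X := by
  intro Y _ hY i hi
  refine (h Y hY i hi).of_dom ((ContinuousMap.id Y).prodMap f) ((ContinuousMap.id Y).prodMap g) ?_
  exact (ContinuousMap.Homotopic.refl (ContinuousMap.id Y)).prodMap hgf

lemma Good.of_retract (h : Good d Z) (f : X → Z) (g : Z → X) (hf : Continuous f)
    (hg : Continuous g) (hgf : ∀ x, g (f x) = x) : Good d X :=
  h.of_dom ⟨f, hf⟩ ⟨g, hg⟩ (by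
    have : (⟨g, hg⟩ : C(Z, X)).comp ⟨f, hf⟩ = ContinuousMap.id X := by ext x; exact hgf x
    rw [this])

lemma Good.of_contractible [ContractibleSpace X] : Good d X := by
  obtain ⟨x, hx⟩ := id_nullhomotopic X
  have hu : Good d Unit := by
    intro Y _ hY i hi
    exact (hY i hi).of_retract Prod.fst (fun y => (y, ())) continuous_fst (by fun_prop)
      (fun x => rfl)
  refine hu.of_dom (ContinuousMap.const X ()) (ContinuousMap.const Unit x) hx.symm

lemma Good.prod (h1 : Good d X) (h2 : Good d Z) : Good d (X × Z) := by
  intro Y _ hY i hi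
  exact (h2 (Y × X) (h1 Y hY) i hi).of_retract (fun x => ((x.1, x.2.1), x.2.2))
    (fun x => (x.1.1, (x.1.2, x.2))) (by fun_prop) (by fun_prop) (fun x => rfl)

lemma Good.of_isEmpty [IsEmpty X] : Good d X := fun _ _ _ i _ => HZ.of_isEmpty i

lemma HZ.strip {Y : Type} [TopologicalSpace Y] {i : ℕ} {A : Set X} {C : Set (Y × X)}
    (hC : ∀ q, q ∈ C ↔ q.2 ∈ A) : HZ i C ↔ HZ i (Y × A) := by
  constructor
  · intro h
    exact h.of_retract (fun q => ⟨(q.1, q.2.1), (hC _).2 q.2.2⟩)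
      (fun q => (q.1.1, ⟨q.1.2, (hC _).1 q.2⟩)) (by fun_prop) (by fun_prop) (fun x => rfl)
  · intro h
    exact h.of_retract (fun q => (q.1.1, ⟨q.1.2, (hC _).1 q.2⟩))
      (fun q => ⟨(q.1, q.2.1), (hC _).2 q.2.2⟩) (by fun_prop) (by fun_prop) (fun x => rfl)

lemma good_mid (A B : Set X) (hA : IsOpen A) (hB : IsOpen B)
    (h1 : Good d (A ∩ B : Set X)) (h2 : Good d (A ∪ B : Set X)) : Good d A := by
  intro Y _ hY i hi
  have := mv_mid_sets (X := Y × X) (Prod.snd ⁻¹' A) (Prod.snd ⁻¹' B) (hA.preimage continuous_snd)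
    (hB.preimage continuous_snd) i ((HZ.strip (fun q => Iff.rfl)).2 (h1 Y hY i hi))
    ((HZ.strip (fun q => Iff.rfl)).2 (h2 Y hY i hi))
  exact (HZ.strip (fun q => Iff.rfl)).1 this

lemma good_disj (A B : Set X) (hA : IsOpen A) (hB : IsOpen B) (h0 : A ∩ B = ∅)
    (h1 : Good d A) (h2 : Good d B) : Good d (A ∪ B : Set X) := by
  intro Y _ hY i hi
  have := mv_disj_sets (X := Y × X) (Prod.snd ⁻¹' A) (Prod.snd ⁻¹' B) (hA.preimage continuous_snd)
    (hB.preimage continuous_snd) i (by rw [← Set.preimage_inter, h0, Set.preimage_empty])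
    ((HZ.strip (fun q => Iff.rfl)).2 (h1 Y hY i hi))
    ((HZ.strip (fun q => Iff.rfl)).2 (h2 Y hY i hi))
  exact (HZ.strip (fun q => Iff.rfl)).1 this

lemma good_fin {ι : Type} [Finite ι] (O : ι → Set X) (hO : ∀ i, IsOpen (O i))
    (hd : ∀ i j, i ≠ j → O i ∩ O j = ∅) (h : ∀ i, Good d (O i)) (hu : ∀ x, ∃ i, x ∈ O i) :
    Good d X := by
  classical
  have key : ∀ s : Finset ι, Good d (⋃ i ∈ s, O i : Set X) := by
    intro s
    induction s using Finset.induction_on with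
    | empty =>
      have : IsEmpty (⋃ i ∈ (∅ : Finset ι), O i : Set X) := by simp
      exact Good.of_isEmpty
    | insert a s ha ih =>
      rw [Finset.set_biUnion_insert]
      refine good_disj _ _ (hO a) (isOpen_biUnion fun i _ => hO i) ?_ (h a) ih
      rw [Set.inter_iUnion₂]
      simp only [Set.iUnion_eq_empty]
      intro i hi
      exact hd _ _ (fun h => ha (h ▸ hi))
  have := Fintype.ofFinite ι
  refine (key Finset.univ).of_retract (fun x => ⟨x, by simpa using hu x⟩) Subtype.val
    (by fun_prop) (by fun_prop) (fun x => rfl)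

end GoodSpaces

end KEq


namespace KEq

section Sphere

lemma Inj.comp {X Y Z : Type} [TopologicalSpace X] [TopologicalSpace Y] [TopologicalSpace Z]
    {i : ℕ} {f : C(X, Y)} {g : C(Y, Z)} (hg : Inj i g) (hf : Inj i f) : Inj i (g.comp f) := by
  intro z hz hb
  rw [pf_comp] at hb
  exact hf z hz (hg _ (hz.pf f) hb)

lemma inj_fst {C Y : Type} [TopologicalSpace C] [TopologicalSpace Y] [ContractibleSpace C]
    (i : ℕ) : Inj i (ContinuousMap.fst : C(Y × C, Y)) := by
  obtain ⟨x, hx⟩ := id_nullhomotopic C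
  refine inj_of_leftInv _ ((ContinuousMap.id Y).prodMk (ContinuousMap.const Y x)) ?_
  exact (ContinuousMap.Homotopic.refl (ContinuousMap.id Y)).prodMap hx.symm

lemma inj_of_retract {X Z : Type} [TopologicalSpace X] [TopologicalSpace Z] {i : ℕ} (f : C(X, Z))
    (g : Z → X) (hg : Continuous g) (hgf : ∀ x, g (f x) = x) : Inj i f :=
  inj_of_leftInv f ⟨g, hg⟩ (by
    have : (⟨g, hg⟩ : C(Z, X)).comp f = ContinuousMap.id X := by ext x; exact hgf x
    rw [this])

/-- Injectivity of the projection off the sphere factor. -/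
def SphInj (m : ℕ) (E : Type) [TopologicalSpace E] [Zero E] : Prop :=
  ∀ (i : ℕ) (Y : Type) [TopologicalSpace Y], (∀ j, i = j + m → HZ j Y) →
    Inj i (ContinuousMap.fst : C(Y × {x : E // x ≠ 0}, Y))

lemma sphInj_zero : SphInj 0 ℝ := by
  intro i Y _ hY
  have hY := hY i rfl
  have hp : ContractibleSpace (Set.Ioi (0 : ℝ)) := (convex_Ioi 0).contractibleSpace ⟨1, by simp⟩
  have hn : ContractibleSpace (Set.Iio (0 : ℝ)) := (convex_Iio 0).contractibleSpace ⟨-1, by simp⟩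
  have := mv_disj_sets (X := Y × ℝ) (Prod.snd ⁻¹' (Set.Ioi (0 : ℝ))) (Prod.snd ⁻¹' (Set.Iio (0 : ℝ)))
    (isOpen_Ioi.preimage continuous_snd) (isOpen_Iio.preimage continuous_snd) i
    (by
      ext q
      simp only [Set.mem_inter_iff, Set.mem_preimage, Set.mem_Ioi, Set.mem_Iio,
        Set.mem_empty_iff_false, iff_false, not_and, not_lt]
      exact le_of_lt)
    ((HZ.strip (A := Set.Ioi (0 : ℝ)) (fun q => Iff.rfl)).2 ((inj_fst i).hz hY))
    ((HZ.strip (A := Set.Iio (0 : ℝ)) (fun q => Iff.rfl)).2 ((inj_fst i).hz hY))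
  have hne : ∀ q : Y × ℝ, q ∈ (Prod.snd ⁻¹' (Set.Ioi (0 : ℝ)) ∪ Prod.snd ⁻¹' (Set.Iio (0 : ℝ)) :
      Set (Y × ℝ)) → q.2 ≠ 0 := by
    rintro q (h | h)
    · exact ne_of_gt h
    · exact ne_of_lt h
  have hne' : ∀ q : Y × {x : ℝ // x ≠ 0}, (q.1, q.2.1) ∈ (Prod.snd ⁻¹' (Set.Ioi (0 : ℝ)) ∪
      Prod.snd ⁻¹' (Set.Iio (0 : ℝ)) : Set (Y × ℝ)) :=
    fun q => (lt_or_gt_of_ne q.2.2).symm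
  exact HZ.inj (this.of_retract (fun q => ⟨(q.1, q.2.1), hne' q⟩)
    (fun q => (q.1.1, ⟨q.1.2, hne _ q.2⟩)) (by fun_prop) (by fun_prop) (fun x => rfl)) _

lemma sphInj_succ (m : ℕ) (E : Type) [NormedAddCommGroup E] [NormedSpace ℝ E] [Nontrivial E]
    (h : SphInj m E) : SphInj (m + 1) (ℝ × E) := by
  intro i Y _ hY
  obtain ⟨e, he⟩ := exists_ne (0 : E)
  let CA : Set (ℝ × E) := {x | ¬ (x.1 ≤ 0 ∧ x.2 = 0)}
  let CB : Set (ℝ × E) := {x | ¬ (0 ≤ x.1 ∧ x.2 = 0)}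
  have hCA : IsOpen CA := by
    have hc : IsClosed {x : ℝ × E | x.1 ≤ 0 ∧ x.2 = 0} := (isClosed_le continuous_fst continuous_const).inter
      (isClosed_eq continuous_snd continuous_const)
    exact hc.isOpen_compl
  have hCB : IsOpen CB := by
    have hc : IsClosed {x : ℝ × E | 0 ≤ x.1 ∧ x.2 = 0} := (isClosed_le continuous_const continuous_fst).inter
      (isClosed_eq continuous_snd continuous_const)
    exact hc.isOpen_compl
  have cA : ContractibleSpace CA := by
    have : StarConvex ℝ ((1 : ℝ), (0 : E)) CA := by
      intro x hx a b ha hb hab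
      simp only [CA, Set.mem_ofPred_eq, Prod.fst_add, Prod.smul_fst, Prod.snd_add, Prod.smul_snd,
        smul_zero, zero_add, smul_eq_mul, mul_one, smul_eq_zero, not_and] at hx ⊢
      intro h1 h2
      rcases h2 with h2 | h2
      · subst h2; linarith
      · have h3 : 0 < x.1 := lt_of_not_ge (fun h4 => hx h4 h2)
        rcases hb.eq_or_lt with h | h
        · subst h; linarith
        · have := mul_pos h h3; linarith
    exact this.contractibleSpace ⟨(1, 0), by simp [CA]⟩
  have cB : ContractibleSpace CB := by
    have : StarConvex ℝ ((-1 : ℝ), (0 : E)) CB := by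
      intro x hx a b ha hb hab
      simp only [CB, Set.mem_ofPred_eq, Prod.fst_add, Prod.smul_fst, Prod.snd_add, Prod.smul_snd,
        smul_zero, zero_add, smul_eq_mul, mul_neg, mul_one, smul_eq_zero, not_and] at hx ⊢
      intro h1 h2
      rcases h2 with h2 | h2
      · subst h2; linarith
      · have h3 : x.1 < 0 := lt_of_not_ge (fun h4 => hx h4 h2)
        rcases hb.eq_or_lt with h | h
        · subst h; linarith
        · have := mul_neg_of_pos_of_neg h h3; linarith
    exact this.contractibleSpace ⟨(-1, 0), by simp [CB]⟩
  have nA : ∀ x ∈ CA, x ≠ 0 := by rintro x hx rfl; simp [CA] at hx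
  have nB : ∀ x ∈ CB, x ≠ 0 := by rintro x hx rfl; simp [CB] at hx
  let A : Set (Y × {x : ℝ × E // x ≠ 0}) := {q | q.2.1 ∈ CA}
  let B : Set (Y × {x : ℝ × E // x ≠ 0}) := {q | q.2.1 ∈ CB}
  have hA : IsOpen A := hCA.preimage (f := fun q : Y × {x : ℝ × E // x ≠ 0} => q.2.1) (by fun_prop)
  have hB : IsOpen B := hCB.preimage (f := fun q : Y × {x : ℝ × E // x ≠ 0} => q.2.1) (by fun_prop)
  have hAB : A ∪ B = Set.univ := by
    ext ⟨y, x, hx⟩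
    simp only [A, B, CA, CB, Set.mem_union, Set.mem_ofPred_eq, Set.mem_univ, iff_true]
    by_contra hcon
    push Not at hcon
    exact hx (Prod.ext (le_antisymm hcon.1.1 hcon.2.1) hcon.1.2)
  have hABe : ∀ q : (A ∩ B : Set _), q.1.2.1.2 ≠ 0 := by
    rintro ⟨⟨y, x, hx⟩, h1, h2⟩ h0
    rcases le_total x.1 0 with h | h
    · exact h1 ⟨h, h0⟩
    · exact h2 ⟨h, h0⟩
  have hcAB : ∀ r : ℝ, ∀ x : E, x ≠ 0 → (r, x) ∈ CA ∧ (r, x) ∈ CB := fun r x hx =>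
    ⟨fun h => hx h.2, fun h => hx h.2⟩
  refine mv_inj A B hA hB hAB i _
    ⟨fun y => ⟨(y, ⟨(0, e), nA _ (hcAB _ _ he).1⟩), (hcAB _ _ he)⟩, by fun_prop⟩ (fun y => rfl)
    ?_ ?_ ?_
  · have := (inj_fst (C := CA) (Y := Y) i).comp (inj_of_retract (X := A) (i := i)
      ⟨fun q => (q.1.1, ⟨q.1.2.1, q.2⟩), by fun_prop⟩
      (fun q => ⟨(q.1, ⟨q.2.1, nA _ q.2.2⟩), q.2.2⟩) (by fun_prop) (fun x => rfl))
    exact this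
  · have := (inj_fst (C := CB) (Y := Y) i).comp (inj_of_retract (X := B) (i := i)
      ⟨fun q => (q.1.1, ⟨q.1.2.1, q.2⟩), by fun_prop⟩
      (fun q => ⟨(q.1, ⟨q.2.1, nB _ q.2.2⟩), q.2.2⟩) (by fun_prop) (fun x => rfl))
    exact this
  · intro j hj
    have h1 := h j Y (fun l hl => hY l (by omega))
    have h2 := h1.comp ((inj_fst (C := ℝ) (Y := Y × {x : E // x ≠ 0}) j).comp
      (inj_of_retract (X := (A ∩ B : Set _)) (i := j)
      ⟨fun q => ((q.1.1, ⟨q.1.2.1.2, hABe q⟩), q.1.2.1.1), by fun_prop⟩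
      (fun q => ⟨(q.1.1, ⟨(q.2, q.1.2.1), nA _ (hcAB _ _ q.1.2.2).1⟩), hcAB _ _ q.1.2.2⟩)
      (by fun_prop) (fun x => rfl)))
    exact h2

lemma SphInj.of_equiv {m : ℕ} {E F : Type} [NormedAddCommGroup E] [NormedSpace ℝ E]
    [NormedAddCommGroup F] [NormedSpace ℝ F] (h : SphInj m F) (e : E ≃L[ℝ] F) : SphInj m E := by
  intro i Y _ hY
  have h1 : ∀ x : E, x ≠ 0 → e x ≠ 0 := fun x hx => by simpa using hx
  have h2 : ∀ x : F, x ≠ 0 → e.symm x ≠ 0 := fun x hx => by simpa using hx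
  refine (h i Y hY).comp (inj_of_retract (X := Y × {x : E // x ≠ 0}) (i := i)
    ⟨fun q => (q.1, ⟨e q.2.1, h1 _ q.2.2⟩), by fun_prop⟩
    (fun q => (q.1, ⟨e.symm q.2.1, h2 _ q.2.2⟩)) (by fun_prop) (fun x => by simp))

lemma sphInj_finrank (m : ℕ) : ∀ (E : Type) [NormedAddCommGroup E] [NormedSpace ℝ E]
    [FiniteDimensional ℝ E], Module.finrank ℝ E = m + 1 → SphInj m E := by
  induction m with
  | zero =>
    intro E _ _ _ hE
    exact sphInj_zero.of_equiv (ContinuousLinearEquiv.ofFinrankEq (by simpa using hE))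
  | succ m ih =>
    intro E _ _ _ hE
    exact (sphInj_succ m (Fin (m + 1) → ℝ) (ih _ (by simp))).of_equiv
      (ContinuousLinearEquiv.ofFinrankEq (by simp [hE]; omega))

lemma good_sphere (d : ℕ) (E : Type) [NormedAddCommGroup E] [NormedSpace ℝ E]
    [FiniteDimensional ℝ E] (hE : Module.finrank ℝ E = d + 1) : Good d {x : E // x ≠ 0} := by
  intro Y _ hY i hi
  refine (sphInj_finrank d E hE i Y ?_).hz (hY i hi)
  rintro j rfl
  exact hY j (fun h => hi (by simpa using h))

end Sphere

end KEq


namespace KEq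

section Tube

variable {E F : Type} [NormedAddCommGroup E] [NormedSpace ℝ E] [NormedAddCommGroup F]
  [NormedSpace ℝ F]

lemma exists_radius (U : Set (E × F)) (hU : IsOpen U) : ∃ ε : E → ℝ, Continuous ε ∧
    (∀ a, (a, (0 : F)) ∈ U → 0 < ε a) ∧
    ∀ a b, (a, (0 : F)) ∈ U → ‖b‖ < ε a → (a, b) ∈ U := by
  by_cases h : Uᶜ.Nonempty
  · refine ⟨fun a => Metric.infDist (a, (0 : F)) Uᶜ,
      (Metric.continuous_infDist_pt _).comp (by fun_prop), ?_, ?_⟩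
    · intro a ha
      exact (hU.isClosed_compl.notMem_iff_infDist_pos h).1 (fun h => h ha)
    · intro a b _ hb
      by_contra hc
      have h1 := Metric.infDist_le_dist_of_mem (x := (a, (0 : F))) (s := Uᶜ) hc
      have h2 : dist (a, (0 : F)) (a, b) = ‖b‖ := by
        rw [Prod.dist_eq]; simp
      rw [h2] at h1
      exact absurd hb (not_lt.2 h1)
  · have : U = Set.univ := by
      rwa [Set.not_nonempty_iff_eq_empty, Set.compl_empty_iff] at h
    subst this
    exact ⟨fun _ => 1, continuous_const, fun _ _ => one_pos, fun _ _ _ _ => trivial⟩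

lemma good_tube (d : ℕ) (U : Set (E × F)) (hU : IsOpen U) (h1 : Good d U)
    (h2 : Good d {a : E // (a, (0 : F)) ∈ U}) (h3 : Good d {b : F // b ≠ 0}) :
    Good d ({q | q ∈ U ∧ q.2 ≠ 0} : Set (E × F)) := by
  obtain ⟨ε, hε, hpos, hin⟩ := exists_radius U hU
  let W : Set (E × F) := {q | (q.1, (0 : F)) ∈ U ∧ ‖q.2‖ < ε q.1}
  have hW : IsOpen W := (hU.preimage (f := fun q : E × F => (q.1, (0 : F))) (by fun_prop)).inter
    (isOpen_lt continuous_snd.norm (hε.comp continuous_fst))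
  let V : Set (E × F) := {q | q ∈ U ∧ q.2 ≠ 0}
  have hV : IsOpen V := hU.inter (isOpen_ne_fun (by fun_prop) (by fun_prop))
  have hVW : V ∪ W = U := by
    ext q
    constructor
    · rintro (h | h)
      · exact h.1
      · exact hin _ _ h.1 h.2
    · intro h
      by_cases h0 : q.2 = 0
      · have hq : (q.1, (0 : F)) ∈ U := by rw [← h0]; exact h
        exact Or.inr ⟨hq, by rw [h0, norm_zero]; exact hpos _ hq⟩
      · exact Or.inl ⟨h, h0⟩
  refine good_mid V W hV hW ?_ (by rw [hVW]; exact h1)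
  let s : E → F → ℝ := fun a b => ε a / (1 + ‖b‖)
  have hs : ∀ a b, (a, (0 : F)) ∈ U → 0 < s a b := fun a b ha =>
    div_pos (hpos a ha) (by positivity)
  have hsb : ∀ a b, (a, (0 : F)) ∈ U → s a b * ‖b‖ < ε a := fun a b ha => by
    have := hpos a ha
    have h1 : 0 < 1 + ‖b‖ := by positivity
    simp only [s]
    rw [div_mul_eq_mul_div, div_lt_iff₀ h1]
    nlinarith
  have hsc : Continuous fun q : E × F => s q.1 q.2 := by
    refine Continuous.div₀ (by fun_prop) (by fun_prop) (fun q => ?_)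
    have : 0 < 1 + ‖q.2‖ := by positivity
    exact this.ne'
  have mem : ∀ a b r, (a, (0 : F)) ∈ U → b ≠ 0 → 0 < r → r * ‖b‖ < ε a → (a, r • b) ∈ V ∩ W := by
    intro a b r ha hb hr hrb
    have hn : ‖r • b‖ < ε a := by rwa [norm_smul, Real.norm_of_nonneg hr.le]
    exact ⟨⟨hin _ _ ha hn, smul_ne_zero hr.ne' hb⟩, ha, hn⟩
  let f : C((V ∩ W : Set (E × F)), {a : E // (a, (0 : F)) ∈ U} × {b : F // b ≠ 0}) :=
    ⟨fun q => (⟨q.1.1, q.2.2.1⟩, ⟨q.1.2, q.2.1.2⟩), by fun_prop⟩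
  let g : C({a : E // (a, (0 : F)) ∈ U} × {b : F // b ≠ 0}, (V ∩ W : Set (E × F))) :=
    ⟨fun q => ⟨(q.1.1, s q.1.1 q.2.1 • q.2.1), mem _ _ _ q.1.2 q.2.2 (hs _ _ q.1.2)
      (hsb _ _ q.1.2)⟩, by
        have : Continuous fun q : {a : E // (a, (0 : F)) ∈ U} × {b : F // b ≠ 0} =>
          s q.1.1 q.2.1 := hsc.comp (by fun_prop : Continuous fun q :
            {a : E // (a, (0 : F)) ∈ U} × {b : F // b ≠ 0} => (q.1.1, q.2.1))
        fun_prop⟩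
  refine (h2.prod h3).of_dom f g ⟨⟨⟨fun p => ⟨(p.2.1.1,
    ((1 - p.1.1) * s p.2.1.1 p.2.1.2 + p.1.1) • p.2.1.2), ?_⟩, ?_⟩, ?_, ?_⟩⟩
  · have ha := p.2.2.2.1
    have hb := p.2.2.2.2
    have t0 := p.1.2.1
    have t1 := p.1.2.2
    have hs1 := hs p.2.1.1 p.2.1.2 ha
    have hs2 := hsb p.2.1.1 p.2.1.2 ha
    refine mem _ _ _ ha p.2.2.1.2 ?_ ?_
    · rcases t0.eq_or_lt with h | h
      · rw [← h]; simpa using hs1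
      · have : 0 ≤ (1 - p.1.1) * s p.2.1.1 p.2.1.2 := mul_nonneg (by linarith) hs1.le
        linarith
    · rcases t0.eq_or_lt with h | h
      · rw [← h]; simpa using hs2
      · have h5 : (1 - p.1.1) * (s p.2.1.1 p.2.1.2 * ‖p.2.1.2‖) ≤ (1 - p.1.1) * ε p.2.1.1 :=
          mul_le_mul_of_nonneg_left hs2.le (by linarith)
        have h6 : p.1.1 * ‖p.2.1.2‖ < p.1.1 * ε p.2.1.1 := mul_lt_mul_of_pos_left hb h
        linarith
  · have : Continuous fun p : unitInterval × (V ∩ W : Set (E × F)) => s p.2.1.1 p.2.1.2 :=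
      hsc.comp (by fun_prop : Continuous fun p : unitInterval × (V ∩ W : Set (E × F)) => p.2.1)
    fun_prop
  · intro q
    apply Subtype.ext
    simp [f, g]
  · intro q
    apply Subtype.ext
    simp

end Tube

end KEq


namespace KEq

section Geometry

/-- The tuple `x` is constant on `S`. -/
def Cst {I : Type} (x : I → ℝ) (S : Finset I) : Prop := ∀ i ∈ S, ∀ j ∈ S, x i = x j

/-- No `k` equal entries. -/
def NE (k : ℕ) {I : Type} (x : I → ℝ) : Prop := ∀ S : Finset I, S.card = k → ¬ Cst x S

lemma NE.comp {k : ℕ} {I J : Type} {f : J → I} (hf : Function.Injective f) {x : I → ℝ}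
    {y : J → ℝ} (h : NE k x) (hxy : ∀ i j, y i = y j → x (f i) = x (f j)) : NE k y := by
  intro S hS hc
  refine h (S.map ⟨f, hf⟩) (by simpa using hS) ?_
  intro i hi j hj
  obtain ⟨a, ha, rfl⟩ := Finset.mem_map.1 hi
  obtain ⟨b, hb, rfl⟩ := Finset.mem_map.1 hj
  exact hxy _ _ (hc a ha b hb)

lemma NE.not_cst {k : ℕ} {I J : Type} {f : J → I} (hf : Function.Injective f) {x : I → ℝ}
    {y : J → ℝ} (h : NE k y) (hxy : ∀ i j, x (f i) = x (f j) → y i = y j) (T : Finset I)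
    (hT : T.card = k) (hr : ∀ i ∈ T, ∃ j, f j = i) (hc : Cst x T) : False := by
  classical
  refine h (T.preimage f hf.injOn) ?_ ?_
  · rw [← hT, ← Finset.card_image_of_injective _ hf, Finset.image_preimage]
    congr 1
    ext i
    simp only [Finset.mem_filter, Set.mem_range]
    exact ⟨fun h => h.1, fun h => ⟨h, hr i h⟩⟩
  · intro i hi j hj
    exact hxy _ _ (hc _ (Finset.mem_preimage.1 hi) _ (Finset.mem_preimage.1 hj))

/-- Partial complements. -/
def UF (k : ℕ) {I : Type} (p : I) (F : Finset (Finset I)) : Set (I → ℝ) :=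
  {x | ∀ S : Finset I, S.card = k → (p ∉ S ∨ S ∈ F) → ¬ Cst x S}

lemma isClosed_cst {I : Type} (S : Finset I) : IsClosed {x : I → ℝ | Cst x S} := by
  have : {x : I → ℝ | Cst x S} = ⋂ i ∈ S, ⋂ j ∈ S, {x : I → ℝ | x i = x j} := by
    ext x; simp [Cst]
  rw [this]
  exact isClosed_biInter fun i _ => isClosed_biInter fun j _ =>
    isClosed_eq (continuous_apply i) (continuous_apply j)

lemma isOpen_UF (k : ℕ) {I : Type} [Finite I] (p : I) (F : Finset (Finset I)) :
    IsOpen (UF k p F) := by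
  have : UF k p F = ⋂ S : Finset I, ⋂ (_ : S.card = k), ⋂ (_ : p ∉ S ∨ S ∈ F),
      {x : I → ℝ | Cst x S}ᶜ := by
    ext x; simp [UF]
  rw [this]
  have : Finite (Finset I) := by
    have := Fintype.ofFinite I
    infer_instance
  exact isOpen_iInter_of_finite fun S => isOpen_iInter_of_finite fun _ =>
    isOpen_iInter_of_finite fun _ => (isClosed_cst S).isOpen_compl

section Signs

variable {k d : ℕ} {J : Type} [Finite J]

/-- Tuples with prescribed signs. -/
def Sg (k : ℕ) {J : Type} (P : J → Bool) : Set (J → ℝ) :=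
  {c | NE k c ∧ ∀ j, (P j = true → 0 < c j) ∧ (P j = false → c j < 0)}

lemma good_Sg (hk : 1 ≤ k) (P : J → Bool)
    (h1 : Good d {u : {j // P j = true} → ℝ // NE k u})
    (h2 : Good d {u : {j // P j = false} → ℝ // NE k u}) : Good d (Sg k P) := by
  have hne : ∀ c : Sg k P, ∀ j, c.1 j ≠ 0 := by
    intro c j
    cases hP : P j with
    | true => exact ((c.2.2 j).1 hP).ne'
    | false => exact ((c.2.2 j).2 hP).ne
  have hu : ∀ c : Sg k P, NE k (fun j : {j // P j = true} => Real.log (c.1 j)) := by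
    intro c
    refine NE.comp Subtype.val_injective c.2.1 ?_
    intro i j hij
    exact Real.log_injOn_pos ((c.2.2 i).1 i.2) ((c.2.2 j).1 j.2) hij
  have hv : ∀ c : Sg k P, NE k (fun j : {j // P j = false} => Real.log (c.1 j)) := by
    intro c
    refine NE.comp Subtype.val_injective c.2.1 ?_
    intro i j hij
    have h3 := (c.2.2 i).2 i.2
    have h4 := (c.2.2 j).2 j.2
    have h5 := congrArg Real.exp hij
    simp only [Real.exp_log_of_neg h3, Real.exp_log_of_neg h4] at h5
    linarith
  let G : ({j // P j = true} → ℝ) → ({j // P j = false} → ℝ) → J → ℝ := fun u v j =>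
    if h : P j = true then Real.exp (u ⟨j, h⟩) else - Real.exp (v ⟨j, by simpa using h⟩)
  have Gt : ∀ u v j (h : P j = true), G u v j = Real.exp (u ⟨j, h⟩) := fun u v j h => by
    simp [G, h]
  have Gf : ∀ u v j (h : P j = false), G u v j = - Real.exp (v ⟨j, h⟩) := fun u v j h => by
    simp [G, h]
  have hG : ∀ u v, NE k u → NE k v → G u v ∈ Sg k P := by
    intro u v hu hv
    refine ⟨?_, fun j => ⟨fun h => ?_, fun h => ?_⟩⟩
    · intro T hT hc
      obtain ⟨i, hi⟩ : T.Nonempty := Finset.card_pos.1 (by omega)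
      cases hP : P i with
      | true =>
        refine NE.not_cst (f := Subtype.val) Subtype.val_injective hu (x := G u v) ?_ T hT ?_ hc
        · intro a b hab
          rw [Gt _ _ _ a.2, Gt _ _ _ b.2] at hab
          exact Real.exp_injective hab
        · intro j hj
          refine ⟨⟨j, ?_⟩, rfl⟩
          by_contra hn
          have := hc i hi j hj
          rw [Gt _ _ _ hP, Gf _ _ _ (by simpa using hn)] at this
          have h1 := Real.exp_pos (u ⟨i, hP⟩)
          have h2 := Real.exp_pos (v ⟨j, by simpa using hn⟩)
          linarith
      | false =>
        refine NE.not_cst (f := Subtype.val) Subtype.val_injective hv (x := G u v) ?_ T hT ?_ hc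
        · intro a b hab
          rw [Gf _ _ _ a.2, Gf _ _ _ b.2, neg_inj] at hab
          exact Real.exp_injective hab
        · intro j hj
          refine ⟨⟨j, ?_⟩, rfl⟩
          by_contra hn
          have := hc i hi j hj
          rw [Gf _ _ _ hP, Gt _ _ _ (by simpa using hn)] at this
          have h1 := Real.exp_pos (v ⟨i, hP⟩)
          have h2 := Real.exp_pos (u ⟨j, by simpa using hn⟩)
          linarith
    · rw [Gt _ _ _ h]; exact Real.exp_pos _
    · rw [Gf _ _ _ h]; linarith [Real.exp_pos (v ⟨j, h⟩)]
  have cG : Continuous fun q : ({j // P j = true} → ℝ) × ({j // P j = false} → ℝ) => G q.1 q.2 := by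
    refine continuous_pi fun j => ?_
    cases hP : P j with
    | true => simp only [Gt _ _ _ hP]; fun_prop
    | false => simp only [Gf _ _ _ hP]; fun_prop
  refine (h1.prod h2).of_retract (fun c => (⟨_, hu c⟩, ⟨_, hv c⟩))
    (fun q => ⟨G q.1.1 q.2.1, hG _ _ q.1.2 q.2.2⟩) ?_ ?_ ?_
  · refine Continuous.prodMk (Continuous.subtype_mk (continuous_pi fun j => ?_) _)
      (Continuous.subtype_mk (continuous_pi fun j => ?_) _)
    · exact Continuous.log ((continuous_apply _).comp continuous_subtype_val) (fun c => hne c _)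
    · exact Continuous.log ((continuous_apply _).comp continuous_subtype_val) (fun c => hne c _)
  · exact Continuous.subtype_mk (cG.comp (by fun_prop : Continuous fun q :
      {u : {j // P j = true} → ℝ // NE k u} × {u : {j // P j = false} → ℝ // NE k u} =>
        (q.1.1, q.2.1))) _
  · intro c
    apply Subtype.ext
    funext j
    cases hP : P j with
    | true =>
      refine (Gt _ _ _ hP).trans ?_
      exact Real.exp_log ((c.2.2 j).1 hP)
    | false =>
      refine (Gf _ _ _ hP).trans ?_
      change - Real.exp (Real.log (c.1 j)) = c.1 j
      rw [Real.exp_log_of_neg ((c.2.2 j).2 hP), neg_neg]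

lemma good_Q (hk : 1 ≤ k)
    (h : ∀ P : J → Prop, Good d {u : {j // P j} → ℝ // NE k u}) :
    Good d {c : J → ℝ // NE k c ∧ ∀ j, c j ≠ 0} := by
  refine good_fin (ι := J → Bool) (fun P => {c | c.1 ∈ Sg k P}) ?_ ?_ ?_ ?_
  · intro P
    have : {c : {c : J → ℝ // NE k c ∧ ∀ j, c j ≠ 0} | c.1 ∈ Sg k P} =
      ⋂ j, ((⋂ (_ : P j = true), {c | 0 < c.1 j}) ∩ (⋂ (_ : P j = false), {c | c.1 j < 0})) := by
      ext c
      simp [Sg, c.2.1]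
    rw [this]
    refine isOpen_iInter_of_finite fun j => IsOpen.inter ?_ ?_
    · exact isOpen_iInter_of_finite fun _ => isOpen_lt continuous_const
        ((continuous_apply _).comp continuous_subtype_val)
    · exact isOpen_iInter_of_finite fun _ => isOpen_lt
        ((continuous_apply _).comp continuous_subtype_val) continuous_const
  · intro P P' hPP
    by_contra hcon
    obtain ⟨c, hc, hc'⟩ := Set.nonempty_iff_ne_empty.2 hcon
    refine hPP (funext fun j => ?_)
    have h1 := hc.2 j
    have h2 := hc'.2 j
    cases e1 : P j <;> cases e2 : P' j
    · rfl
    · exact absurd (h1.2 e1) (not_lt.2 (h2.1 e2).le)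
    · exact absurd (h2.2 e2) (not_lt.2 (h1.1 e1).le)
    · rfl
  · intro P
    exact (good_Sg hk P (h _) (h _)).of_retract (fun c => ⟨c.1.1, c.2⟩)
      (fun c => ⟨⟨c.1, c.2.1, fun j => by
        cases hP : P j with
        | true => exact ((c.2.2 j).1 hP).ne'
        | false => exact ((c.2.2 j).2 hP).ne⟩, c.2⟩) (by fun_prop) (by fun_prop) (fun x => rfl)
  · intro c
    refine ⟨fun j => decide (0 < c.1 j), c.2.1, fun j => ⟨fun h => by simpa using h, fun h => ?_⟩⟩
    have : c.1 j ≤ 0 := by simpa using h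
    exact lt_of_le_of_ne this (c.2.2 j)

end Signs

end Geometry

end KEq


namespace KEq

section Main

open Classical in
/-- Coordinates adapted to a stratum. -/
noncomputable def Psi {I : Type} (R : Finset I) (p : I) (hp : p ∉ R) (a : {j // j ∉ R} → ℝ)
    (b : {r // r ∈ R} → ℝ) : I → ℝ :=
  fun i => if h : i ∈ R then b ⟨i, h⟩ + a ⟨p, hp⟩ else a ⟨i, h⟩

lemma Psi_mem {I : Type} {R : Finset I} {p : I} (hp : p ∉ R) (a : {j // j ∉ R} → ℝ)
    (b : {r // r ∈ R} → ℝ) {i : I} (h : i ∈ R) : Psi R p hp a b i = b ⟨i, h⟩ + a ⟨p, hp⟩ := by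
  simp [Psi, h]

lemma Psi_not {I : Type} {R : Finset I} {p : I} (hp : p ∉ R) (a : {j // j ∉ R} → ℝ)
    (b : {r // r ∈ R} → ℝ) {i : I} (h : i ∉ R) : Psi R p hp a b i = a ⟨i, h⟩ := by
  simp [Psi, h]

lemma continuous_Psi {I : Type} (R : Finset I) (p : I) (hp : p ∉ R) :
    Continuous fun q : ({j // j ∉ R} → ℝ) × ({r // r ∈ R} → ℝ) => Psi R p hp q.1 q.2 := by
  refine continuous_pi fun i => ?_
  by_cases h : i ∈ R
  · simp only [Psi_mem hp _ _ h]; fun_prop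
  · simp only [Psi_not hp _ _ h]; fun_prop

variable {k d : ℕ} {I : Type} [Fintype I]

lemma good_Z (p : I) (F : Finset (Finset I)) (R S : Finset I) (hp : p ∉ R)
    (hRS : ∀ i, i ∈ S ↔ i = p ∨ i ∈ R) (hR : R.card + 1 = k) (hS : S.card = k) (hSF : S ∉ F)
    (hQ : Good d {c : {j // j ∉ S} → ℝ // NE k c ∧ ∀ j, c j ≠ 0}) :
    Good d {a : {j // j ∉ R} → ℝ // (a, (0 : {r // r ∈ R} → ℝ)) ∈
      {q : ({j // j ∉ R} → ℝ) × ({r // r ∈ R} → ℝ) | Psi R p hp q.1 q.2 ∈ UF k p F}} := by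
  classical
  have hR' : ∀ j, j ∉ S → j ∉ R := fun j hj hjR => hj ((hRS j).2 (Or.inr hjR))
  have hpS : p ∈ S := (hRS p).2 (Or.inl rfl)
  have hx : ∀ a : {j // j ∉ R} → ℝ, ∀ i ∈ S, Psi R p hp a 0 i = a ⟨p, hp⟩ := by
    intro a i hi
    by_cases h : i ∈ R
    · rw [Psi_mem hp _ _ h]; simp
    · rw [Psi_not hp _ _ h]
      have := ((hRS i).1 hi).resolve_right h
      subst this
      rfl
  let f : ({j // j ∉ R} → ℝ) → ({j // j ∉ S} → ℝ) := fun a j =>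
    a ⟨j.1, hR' _ j.2⟩ - a ⟨p, hp⟩
  let g : ℝ → ({j // j ∉ S} → ℝ) → ({j // j ∉ R} → ℝ) := fun t c j =>
    if h : j.1 ∈ S then t else c ⟨j.1, h⟩ + t
  have hf : ∀ a : {j // j ∉ R} → ℝ, Psi R p hp a 0 ∈ UF k p F → NE k (f a) ∧ ∀ j, f a j ≠ 0 := by
    intro a ha
    refine ⟨?_, ?_⟩
    · intro T hT hc
      refine ha (T.map ⟨Subtype.val, Subtype.val_injective⟩) (by simpa using hT) (Or.inl ?_) ?_
      · intro hpT
        obtain ⟨j, -, hj⟩ := Finset.mem_map.1 hpT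
        exact j.2 (by rw [show j.1 = p from hj]; exact hpS)
      · intro i hi j hj
        obtain ⟨u, hu, rfl⟩ := Finset.mem_map.1 hi
        obtain ⟨v, hv, rfl⟩ := Finset.mem_map.1 hj
        have := hc u hu v hv
        change Psi R p hp a 0 u.1 = Psi R p hp a 0 v.1
        rw [Psi_not hp _ _ (hR' _ u.2), Psi_not hp _ _ (hR' _ v.2)]
        simpa [f] using this
    · intro j hj
      have hjp : Psi R p hp a 0 j.1 = a ⟨p, hp⟩ := by
        rw [Psi_not hp _ _ (hR' _ j.2)]
        simpa [f, sub_eq_zero] using hj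
      have hc : ∀ i ∈ insert j.1 R, Psi R p hp a 0 i = a ⟨p, hp⟩ := by
        intro i hi
        rcases Finset.mem_insert.1 hi with rfl | hi
        · exact hjp
        · exact hx a i ((hRS i).2 (Or.inr hi))
      refine ha (insert j.1 R) ?_ (Or.inl ?_) ?_
      · rw [Finset.card_insert_of_notMem (hR' _ j.2), hR]
      · intro h
        rcases Finset.mem_insert.1 h with h | h
        · exact j.2 (h ▸ hpS)
        · exact hp h
      · intro u hu v hv
        rw [hc u hu, hc v hv]
  have g1 : ∀ t c, g t c ⟨p, hp⟩ = t := fun t c => by simp [g, hpS]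
  have hg : ∀ t (c : {j // j ∉ S} → ℝ), NE k c → (∀ j, c j ≠ 0) →
      Psi R p hp (g t c) 0 ∈ UF k p F := by
    intro t c hc hc0 T hT hcond hcst
    have e1 : ∀ i ∈ S, Psi R p hp (g t c) 0 i = t := fun i hi => by rw [hx _ i hi, g1]
    have e2 : ∀ i (hi : i ∉ S), Psi R p hp (g t c) 0 i = c ⟨i, hi⟩ + t := fun i hi => by
      rw [Psi_not hp _ _ (hR' _ hi)]; simp [g, hi]
    by_cases hTS : ∃ i ∈ T, i ∈ S
    · obtain ⟨i, hiT, hiS⟩ := hTS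
      have hsub : T ⊆ S := by
        intro j hj
        by_contra hjS
        have := hcst i hiT j hj
        rw [e1 i hiS, e2 j hjS] at this
        exact hc0 ⟨j, hjS⟩ (by linarith)
      have hTeq : T = S := Finset.eq_of_subset_of_card_le hsub (by omega)
      subst hTeq
      rcases hcond with h | h
      · exact h hpS
      · exact hSF h
    · push Not at hTS
      refine NE.not_cst (f := Subtype.val) Subtype.val_injective hc
        (x := Psi R p hp (g t c) 0) ?_ T hT (fun i hi => ⟨⟨i, hTS i hi⟩, rfl⟩) hcst
      intro i j hij
      rw [e2 _ i.2, e2 _ j.2] at hij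
      exact add_right_cancel hij
  have hfc : Continuous f := by
    refine continuous_pi fun j => ?_
    simp only [f]; fun_prop
  have hgc : Continuous fun q : ℝ × ({j // j ∉ S} → ℝ) => g q.1 q.2 := by
    refine continuous_pi fun j => ?_
    by_cases h : j.1 ∈ S
    · simp only [g, h, dite_true]; fun_prop
    · simp only [g, h, dite_false]; fun_prop
  refine ((Good.of_contractible (X := ℝ)).prod hQ).of_retract
    (fun a => (a.1 ⟨p, hp⟩, ⟨f a.1, hf a.1 a.2⟩))
    (fun q => ⟨g q.1 q.2.1, hg _ _ q.2.2.1 q.2.2.2⟩) ?_ ?_ ?_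
  · exact Continuous.prodMk ((continuous_apply _).comp continuous_subtype_val)
      (Continuous.subtype_mk (hfc.comp continuous_subtype_val) _)
  · exact Continuous.subtype_mk (hgc.comp (continuous_fst.prodMk
      (continuous_subtype_val.comp continuous_snd))) _
  · intro a
    apply Subtype.ext
    funext j
    change g (a.1 ⟨p, hp⟩) (f a.1) j = a.1 j
    by_cases h : j.1 ∈ S
    · have := ((hRS j.1).1 h).resolve_right j.2
      have hj : j = ⟨p, hp⟩ := Subtype.ext this
      rw [hj, g1]
    · simp [g, f, h]

lemma good_step (hk : 3 ≤ k) (p : I) (F : Finset (Finset I)) (S : Finset I) (hpS : p ∈ S)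
    (hS : S.card = k) (hSF : S ∉ F) (hU : Good (k - 2) (UF k p F))
    (hQ : Good (k - 2) {c : {j // j ∉ S} → ℝ // NE k c ∧ ∀ j, c j ≠ 0}) :
    Good (k - 2) ({x | x ∈ UF k p F ∧ ¬ Cst x S} : Set (I → ℝ)) := by
  classical
  let R := S.erase p
  have hp : p ∉ R := Finset.notMem_erase p S
  have hRS : ∀ i, i ∈ S ↔ i = p ∨ i ∈ R := by
    intro i
    simp only [R, Finset.mem_erase]
    by_cases h : i = p
    · subst h; simp [hpS]
    · simp [h]
  have hR : R.card + 1 = k := by rw [← hS]; exact Finset.card_erase_add_one hpS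
  let Phi : (I → ℝ) → ({j // j ∉ R} → ℝ) × ({r // r ∈ R} → ℝ) := fun x =>
    (fun j => x j.1, fun r => x r.1 - x p)
  have hPhi : Continuous Phi := by simp only [Phi]; fun_prop
  have hPP : ∀ x, Psi R p hp (Phi x).1 (Phi x).2 = x := by
    intro x
    funext i
    by_cases h : i ∈ R
    · rw [Psi_mem hp _ _ h]; simp [Phi]
    · rw [Psi_not hp _ _ h]
  have hPP' : ∀ q : ({j // j ∉ R} → ℝ) × ({r // r ∈ R} → ℝ), Phi (Psi R p hp q.1 q.2) = q := by
    intro q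
    refine Prod.ext ?_ ?_
    · funext j
      exact Psi_not hp _ _ j.2
    · funext r
      change Psi R p hp q.1 q.2 r.1 - Psi R p hp q.1 q.2 p = q.2 r
      rw [Psi_mem hp _ _ r.2, Psi_not hp _ _ hp]
      simp
  have hcst : ∀ x, (Phi x).2 = 0 ↔ Cst x S := by
    intro x
    constructor
    · intro h
      have h1 : ∀ i ∈ S, x i = x p := by
        intro i hi
        rcases (hRS i).1 hi with rfl | hi
        · rfl
        · have := congrFun h ⟨i, hi⟩
          simpa [Phi, sub_eq_zero] using this
      intro i hi j hj
      rw [h1 i hi, h1 j hj]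
    · intro h
      funext r
      simp only [Phi, Pi.zero_apply, sub_eq_zero]
      exact h _ ((hRS _).2 (Or.inr r.2)) _ hpS
  let U' : Set (({j // j ∉ R} → ℝ) × ({r // r ∈ R} → ℝ)) := {q | Psi R p hp q.1 q.2 ∈ UF k p F}
  have hU' : IsOpen U' := (isOpen_UF k p F).preimage (continuous_Psi R p hp)
  have hmem : ∀ x, x ∈ UF k p F → Phi x ∈ U' := by
    intro x hx
    change Psi R p hp (Phi x).1 (Phi x).2 ∈ UF k p F
    rwa [hPP]
  have gU' : Good (k - 2) U' := hU.of_retract (fun q => ⟨Psi R p hp q.1.1 q.1.2, q.2⟩)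
    (fun x => ⟨Phi x.1, hmem _ x.2⟩)
    (Continuous.subtype_mk ((continuous_Psi R p hp).comp continuous_subtype_val) _)
    (Continuous.subtype_mk (hPhi.comp continuous_subtype_val) _)
    (fun q => Subtype.ext (hPP' q.1))
  have key := good_tube (k - 2) U' hU' gU' (good_Z p F R S hp hRS hR hS hSF hQ)
    (good_sphere (k - 2) ({r // r ∈ R} → ℝ) (by simp; omega))
  refine key.of_retract (fun x => ⟨Phi x.1, hmem _ x.2.1, fun h => x.2.2 ((hcst _).1 h)⟩)
    (fun q => ⟨Psi R p hp q.1.1 q.1.2, q.2.1, fun h => q.2.2 ?_⟩)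
    (Continuous.subtype_mk (hPhi.comp continuous_subtype_val) _)
    (Continuous.subtype_mk ((continuous_Psi R p hp).comp continuous_subtype_val) _)
    (fun x => Subtype.ext (hPP x.1))
  have := (hcst _).2 h
  rwa [hPP'] at this

lemma good_base (p : I) (h : Good d {u : {j // j ≠ p} → ℝ // NE k u}) :
    Good d (UF k p ∅) := by
  classical
  let g : ({j // j ≠ p} → ℝ) → ℝ → I → ℝ := fun u t i => if h : i = p then t else u ⟨i, h⟩
  have g1 : ∀ u t i (h : i ≠ p), g u t i = u ⟨i, h⟩ := fun u t i h => by simp [g, h]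
  have g0 : ∀ u t, g u t p = t := fun u t => by simp [g]
  have hgc : Continuous fun q : ({j // j ≠ p} → ℝ) × ℝ => g q.1 q.2 := by
    refine continuous_pi fun i => ?_
    by_cases h : i = p
    · subst h; simp only [g0]; fun_prop
    · simp only [g1 _ _ _ h]; fun_prop
  have hf : ∀ x : I → ℝ, x ∈ UF k p ∅ → NE k (fun j : {j // j ≠ p} => x j.1) := by
    intro x hx T hT hc
    refine hx (T.map ⟨Subtype.val, Subtype.val_injective⟩) (by simpa using hT) (Or.inl ?_) ?_
    · intro hpT
      obtain ⟨j, -, hj⟩ := Finset.mem_map.1 hpT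
      exact j.2 hj
    · intro i hi j hj
      obtain ⟨u, hu, rfl⟩ := Finset.mem_map.1 hi
      obtain ⟨v, hv, rfl⟩ := Finset.mem_map.1 hj
      exact hc u hu v hv
  have hg : ∀ u t, NE k u → g u t ∈ UF k p ∅ := by
    intro u t hu T hT hcond hc
    have hpT : p ∉ T := hcond.resolve_right (by simp)
    refine NE.not_cst (f := Subtype.val) Subtype.val_injective hu (x := g u t) ?_ T hT
      (fun i hi => ⟨⟨i, fun h => hpT (h ▸ hi)⟩, rfl⟩) hc
    intro i j hij
    rwa [g1 _ _ _ i.2, g1 _ _ _ j.2] at hij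
  refine (h.prod (Good.of_contractible (X := ℝ))).of_retract
    (fun x => (⟨_, hf x.1 x.2⟩, x.1 p)) (fun q => ⟨g q.1.1 q.2, hg _ _ q.1.2⟩) ?_ ?_ ?_
  · exact Continuous.prodMk (Continuous.subtype_mk (continuous_pi fun j =>
      (continuous_apply j.1).comp continuous_subtype_val) _)
      ((continuous_apply _).comp continuous_subtype_val)
  · exact Continuous.subtype_mk (hgc.comp ((continuous_subtype_val.comp continuous_fst).prodMk
      continuous_snd)) _
  · intro x
    apply Subtype.ext
    funext i
    by_cases h : i = p
    · subst h; exact g0 _ _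
    · exact g1 _ _ _ h

theorem good_NE (hk : 3 ≤ k) (m : ℕ) : ∀ (I : Type) [Fintype I], Fintype.card I = m →
    Good (k - 2) {x : I → ℝ // NE k x} := by
  classical
  induction m using Nat.strong_induction_on with
  | _ m ih =>
  intro I _ hI
  rcases isEmpty_or_nonempty I with hE | ⟨⟨p⟩⟩
  · have h0 : NE k (fun i : I => (isEmptyElim i : ℝ)) := by
      intro S hS
      have : S = ∅ := Finset.eq_empty_of_isEmpty S
      subst this
      rw [Finset.card_empty] at hS
      omega
    refine (Good.of_contractible (X := Unit)).of_retract (fun _ => ())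
      (fun _ => ⟨fun i => isEmptyElim i, h0⟩) continuous_const continuous_const ?_
    intro x
    apply Subtype.ext
    funext i
    exact isEmptyElim i
  have key : ∀ F : Finset (Finset I), Good (k - 2) (UF k p F) := by
    intro F
    induction F using Finset.induction_on with
    | empty =>
      refine good_base p (ih _ ?_ _ rfl)
      rw [← hI]
      exact Fintype.card_subtype_lt (x := p) (by simp)
    | insert S F hSF hF =>
      by_cases hS : S.card = k ∧ p ∈ S
      · have heq : UF k p (insert S F) = {x | x ∈ UF k p F ∧ ¬ Cst x S} := by
          ext x
          constructor
          · intro hx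
            exact ⟨fun T hT hc => hx T hT (hc.imp id (Finset.mem_insert_of_mem)),
              hx S hS.1 (Or.inr (Finset.mem_insert_self _ _))⟩
          · rintro ⟨h1, h2⟩ T hT hc
            rcases hc with hc | hc
            · exact h1 T hT (Or.inl hc)
            · rcases Finset.mem_insert.1 hc with rfl | hc
              · exact h2
              · exact h1 T hT (Or.inr hc)
        rw [heq]
        refine good_step hk p F S hS.2 hS.1 hSF hF (good_Q (by omega) fun P => ih _ ?_ _ rfl)
        rw [← hI]
        refine (Fintype.card_subtype_le _).trans_lt ?_
        exact Fintype.card_subtype_lt (x := p) (by simpa using hS.2)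
      · have heq : UF k p (insert S F) = UF k p F := by
          ext x
          constructor
          · intro hx T hT hc
            exact hx T hT (hc.imp id (Finset.mem_insert_of_mem))
          · intro h1 T hT hc
            rcases hc with hc | hc
            · exact h1 T hT (Or.inl hc)
            · rcases Finset.mem_insert.1 hc with rfl | hc
              · exact h1 T hT (Or.inl fun h => hS ⟨hT, h⟩)
              · exact h1 T hT (Or.inr hc)
        rw [heq]
        exact hF
  refine (key Finset.univ).of_retract (fun x => ⟨x.1, fun T hT _ => x.2 T hT⟩)
    (fun x => ⟨x.1, fun T hT => x.2 T hT (Or.inr (Finset.mem_univ _))⟩) (by fun_prop) (by fun_prop)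
    (fun x => rfl)

lemma bd_unit (n : ℕ) (c : SC (n + 1) Unit) :
    bd n Unit c = Finsupp.single (ContinuousMap.const _ ())
      ((if Even (n + 2) then 0 else 1) * c (ContinuousMap.const _ ())) := by
  have hc : c = Finsupp.single (ContinuousMap.const _ ()) (c (ContinuousMap.const _ ())) := by
    ext σ
    have : σ = ContinuousMap.const _ () := rfl
    rw [this, Finsupp.single_eq_same]
  have h1 : ∀ a : ℤ, bd n Unit (Finsupp.single (ContinuousMap.const _ ()) a) =
      Finsupp.single (ContinuousMap.const _ ()) ((if Even (n + 2) then 0 else 1) * a) := by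
    intro a
    have : (Finsupp.single (ContinuousMap.const _ ()) a : SC (n + 1) Unit) =
      a • Finsupp.single (ContinuousMap.const _ ()) 1 := by simp
    rw [this, map_smul, bd_single]
    have h2 : ∀ j : Fin (n + 2), (ContinuousMap.const (stdSimplex ℝ (Fin (n + 2))) ()).comp
      (smap j.succAbove) = ContinuousMap.const _ () := fun j => rfl
    simp only [h2]
    rw [← Finset.sum_smul, Fin.sum_neg_one_pow]
    split_ifs <;> simp
  exact (congrArg _ hc).trans (h1 _)

lemma hz_unit (n : ℕ) : HZ (n + 1) Unit := by
  intro z hz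
  by_cases h : Even n
  · refine ⟨Finsupp.single (ContinuousMap.const _ ()) (z (ContinuousMap.const _ ())), ?_⟩
    have h3 : ¬ Even (n + 1 + 2) := by
      rw [Nat.even_add, Nat.even_add_one]; simp [h]
    rw [bd_unit, if_neg h3, Finsupp.single_eq_same, one_mul]
    ext σ
    have : σ = ContinuousMap.const _ () := rfl
    rw [this, Finsupp.single_eq_same]
  · have h3 : ¬ Even (n + 2) := by
      rw [Nat.even_add]; simp [h]
    simp only [Cyc] at hz
    rw [bd_unit, if_neg h3, one_mul, Finsupp.single_eq_zero] at hz
    refine ⟨0, ?_⟩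
    rw [map_zero]
    ext σ
    have : σ = ContinuousMap.const _ () := rfl
    rw [this, hz]
    rfl

theorem hz_final (n k : ℕ) (hk : 3 ≤ k) (i : ℕ) (hi : ¬ (k - 2) ∣ i) :
    HZ i (kEqualComplement n k) := by
  have h := good_NE hk (n + 1) (Fin (n + 1)) (by simp)
  have hu : ∀ i, ¬ (k - 2) ∣ i → HZ i Unit := by
    intro i hi
    cases i with
    | zero => exact absurd (dvd_zero _) hi
    | succ n => exact hz_unit n
  exact (h Unit hu i hi).of_retract (fun x => ((), ⟨x.1, x.2⟩)) (fun q => ⟨q.2.1, q.2.2⟩)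
    (by fun_prop) (by fun_prop) (fun x => rfl)

end Main

end KEq

theorem homology_of_k_equal_complement_vanishes (n k : ℕ) (hk : 3 ≤ k) (hkn : k ≤ n)
    (i : ℕ) (hi : 1 ≤ i) (hnt : ¬ ∃ t : ℕ, 1 ≤ t ∧ i = t * (k - 2)) :
    Subsingleton (singularHomology (TopCat.of (kEqualComplement n k)) i) := by
  refine (KEq.hz_iff i).2 (KEq.hz_final n k hk i ?_)
  rintro ⟨t, rfl⟩
  refine hnt ⟨t, ?_, mul_comm _ _⟩
  rcases t with _ | t
  · simp at hi
  · omega
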